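/- There is an absolute constant c such that for any prime p, subsets A, B ⊆ F_p with |A| = A ≤ |B| = B, λ, μ ∈ F_p^*, and any integer N with 1 < N, 2AB/p ≤ N ≤ A, the number of pairs (a,b) ∈ F_p^2 with N < ι(ℓ_{λa,μb}) ≤ 2N is at most c·min(pAB/N², A³B²/N⁴). -/

import Mathlib

open Finset

/-- Incidence count: number of points of `A × B` on the line `y = a x + b`. -/
def inc {p : ℕ} [Fact p.Prime] (A B : Finset (ZMod p)) (a b : ZMod p) : ℕ :=
  ((A ×ˢ B).filter (fun xy => xy.2 = a * xy.1 + b)).card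

open Finset

open MvPolynomial in
/-- flex polynomial in two variables -/
noncomputable def flexP {R σ : Type*} [CommRing R] (i j : σ) (h : MvPolynomial σ R) : MvPolynomial σ R :=
  pderiv i (pderiv i h) * (pderiv j h)^2 - 2 * pderiv i (pderiv j h) * pderiv i h * pderiv j h
    + pderiv j (pderiv j h) * (pderiv i h)^2

section Planar
open MvPolynomial

variable {k : Type*} [Field k]

/-- embedding -/
noncomputable def emb3 (k : Type*) [Field k] : MvPolynomial (Fin 2) k →ₐ[k] MvPolynomial (Fin 3) k :=
  aeval ![X 0, X 1]

/-- derivation -/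
noncomputable def derE (k : Type*) [Field k] : Derivation k (MvPolynomial (Fin 3) k) (MvPolynomial (Fin 3) k) :=
  mkDerivation k ![1, X 2, 0]

lemma derE_emb (g : MvPolynomial (Fin 2) k) :
    derE k (emb3 k g) = emb3 k (pderiv 0 g) + X 2 * emb3 k (pderiv 1 g) := by
  induction g using MvPolynomial.induction_on with
  | C a => simp [emb3, derE]
  | add f g hf hg => simp only [map_add, hf, hg]; ring
  | mul_X f i hf =>
    simp only [map_mul, Derivation.leibniz, hf, smul_eq_mul]
    fin_cases i <;> simp [emb3, derE, mkDerivation_X, pderiv_X] <;> ring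

lemma pderiv_comm2 (g : MvPolynomial (Fin 2) k) :
    pderiv 1 (pderiv 0 g) = pderiv 0 (pderiv 1 g) := by
  induction g using MvPolynomial.induction_on with
  | C a => simp
  | add f g hf hg => simp only [map_add, hf, hg]
  | mul_X f i hf =>
    simp only [Derivation.leibniz, smul_eq_mul, map_add, hf]
    fin_cases i <;> simp [pderiv_X] <;> ring

lemma stepJ (h : MvPolynomial (Fin 2) k) (hH : h ∣ flexP 0 1 h) (Φ : MvPolynomial (Fin 3) k)
    (hJ : ∃ (n : ℕ) (a b : MvPolynomial (Fin 3) k),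
      (emb3 k (pderiv 1 h))^n * Φ = emb3 k h * a + derE k (emb3 k h) * b) :
    ∃ (n : ℕ) (a b : MvPolynomial (Fin 3) k),
      (emb3 k (pderiv 1 h))^n * derE k Φ = emb3 k h * a + derE k (emb3 k h) * b := by
  obtain ⟨n, a, b, hab⟩ := hJ
  obtain ⟨c, hc⟩ := hH
  have hc' := congrArg (emb3 k) hc
  simp only [flexP, map_add, map_sub, map_mul, map_pow] at hc'
  have h1 := derE_emb h
  have h2 : derE k (derE k (emb3 k h)) = emb3 k (pderiv 0 (pderiv 0 h)) +
      2 * X 2 * emb3 k (pderiv 0 (pderiv 1 h)) + (X 2)^2 * emb3 k (pderiv 1 (pderiv 1 h)) := by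
    rw [h1]
    simp only [map_add, Derivation.leibniz, derE_emb, smul_eq_mul]
    rw [pderiv_comm2]
    have : derE k (X 2) = 0 := by simp [derE, mkDerivation_X]
    rw [this]; ring
  have h3 := congrArg (derE k) hab
  simp only [map_add, Derivation.leibniz, smul_eq_mul, Derivation.leibniz_pow, nsmul_eq_mul] at h3
  have h4 : (n:MvPolynomial (Fin 3) k) * (emb3 k (pderiv 1 h))^(n-1) * emb3 k (pderiv 1 h) = n * (emb3 k (pderiv 1 h))^n := by
    cases n with
    | zero => simp
    | succ n => simp [pow_succ]; ring
  simp only [map_ofNat] at hc'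
  set u := emb3 k (pderiv 1 h)
  set v := emb3 k (pderiv 0 h)
  set g := derE k (emb3 k h)
  set xx := emb3 k (pderiv 0 (pderiv 0 h))
  set xz := emb3 k (pderiv 0 (pderiv 1 h))
  set zz := emb3 k (pderiv 1 (pderiv 1 h))
  set H := emb3 k h
  set s : MvPolynomial (Fin 3) k := X 2
  have h5 : u^2 * derE k g = H * emb3 k c + g * (2*u*xz + (g - 2*v)*zz) := by
    rw [h2, ← hc', h1]; ring
  refine ⟨n+3, u^3*derE k a + u*emb3 k c*b - u^2*n*derE k u * a,
    u^3*a + u^3 * derE k b + u*b*(2*u*xz + (g - 2*v)*zz) - u^2*n*derE k u * b, ?_⟩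
  have e1 : u^(n+3) * derE k Φ = u^3 * (u^n * derE k Φ + Φ * ((n:MvPolynomial (Fin 3) k) * (u^(n-1) * derE k u)))
     - u^2*derE k u * Φ * (n * u^(n-1) * u) := by ring
  rw [e1, h3, h4]
  have e2 : u^2 * derE k u * Φ * (n*u^n) = u^2*derE k u * n * (u^n*Φ) := by ring
  rw [e2, hab]
  linear_combination u * b * h5

lemma iterJ (h : MvPolynomial (Fin 2) k) (hH : h ∣ flexP 0 1 h) (j : ℕ) :
    ∃ (n : ℕ) (a b : MvPolynomial (Fin 3) k),
      (emb3 k (pderiv 1 h))^n * ((derE k)^[j] (emb3 k h)) = emb3 k h * a + derE k (emb3 k h) * b := by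
  induction j with
  | zero => exact ⟨0, 1, 0, by simp⟩
  | succ j ih =>
    rw [Function.iterate_succ_apply']
    exact stepJ h hH _ ih

variable {Q : Type*} [Field Q] [Algebra k Q]

/-- the map to Q[t] -/
noncomputable def tay (ξ ζ s : Q) : MvPolynomial (Fin 3) k →ₐ[k] Polynomial Q :=
  aeval ![Polynomial.C ξ + Polynomial.X, Polynomial.C ζ + Polynomial.C s * Polynomial.X, Polynomial.C s]

lemma tay_der (ξ ζ s : Q) (Φ : MvPolynomial (Fin 3) k) :
    Polynomial.derivative (tay ξ ζ s Φ) = tay ξ ζ s (derE k Φ) := by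
  induction Φ using MvPolynomial.induction_on with
  | C a => simp [tay, derE, Polynomial.algebraMap_apply]
  | add f g hf hg => simp only [map_add, hf, hg]
  | mul_X f i hf =>
    simp only [map_mul, Derivation.leibniz, Polynomial.derivative_mul, hf, smul_eq_mul, map_add]
    fin_cases i <;> simp [tay, derE, mkDerivation_X] <;> ring

lemma tay_iter (ξ ζ s : Q) (j : ℕ) (Φ : MvPolynomial (Fin 3) k) :
    Polynomial.derivative^[j] (tay ξ ζ s Φ) = tay ξ ζ s ((derE k)^[j] Φ) := by
  induction j with
  | zero => rfl
  | succ j ih => rw [Function.iterate_succ_apply', Function.iterate_succ_apply', ih, tay_der]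

lemma tay_eval (ξ ζ s t : Q) (Φ : MvPolynomial (Fin 3) k) :
    Polynomial.eval t (tay ξ ζ s Φ) = aeval ![ξ + t, ζ + s * t, s] Φ := by
  induction Φ using MvPolynomial.induction_on with
  | C a => simp [tay, Polynomial.algebraMap_apply]
  | add f g hf hg => simp only [map_add, hf, hg, Polynomial.eval_add]
  | mul_X f i hf =>
    simp only [map_mul, hf, Polynomial.eval_mul]
    fin_cases i <;> simp [tay]

lemma aeval_emb (ξ ζ s : Q) (g : MvPolynomial (Fin 2) k) :
    aeval ![ξ, ζ, s] (emb3 k g) = aeval ![ξ, ζ] g := by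
  induction g using MvPolynomial.induction_on with
  | C a => simp [emb3]
  | add f g hf hg => simp only [map_add, hf, hg]
  | mul_X f i hf =>
    simp only [map_mul, hf]
    fin_cases i <;> simp [emb3]

lemma natDegree_aeval_le {σ : Type*} (f : σ → Polynomial Q) (hf : ∀ i, (f i).natDegree ≤ 1) (h : MvPolynomial σ k) :
    (aeval f h).natDegree ≤ h.totalDegree := by
  rw [aeval_def, eval₂_eq]
  refine Polynomial.natDegree_sum_le_of_forall_le _ _ ?_
  intro d hd
  refine (Polynomial.natDegree_mul_le).trans ?_
  have : (algebraMap k (Polynomial Q) (coeff d h)).natDegree = 0 := by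
    rw [Polynomial.algebraMap_apply]; simp
  rw [this, zero_add]
  refine (Polynomial.natDegree_prod_le _ _).trans ?_
  refine le_trans ?_ (le_totalDegree hd)
  rw [Finsupp.sum]
  refine Finset.sum_le_sum fun i _ => ?_
  refine (Polynomial.natDegree_pow_le).trans ?_
  calc _ ≤ d i * 1 := Nat.mul_le_mul_left _ (hf i)
    _ = _ := mul_one _

lemma line_in (p : ℕ) [Fact p.Prime] [CharP k p] (h : MvPolynomial (Fin 2) k) (hH : h ∣ flexP 0 1 h)
    (hdeg : h.totalDegree < p) (ξ ζ s : Q) (h0 : aeval ![ξ, ζ] h = 0)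
    (h1 : aeval ![ξ, ζ] (pderiv 1 h) ≠ 0)
    (hs : aeval ![ξ, ζ] (pderiv 0 h) + s * aeval ![ξ, ζ] (pderiv 1 h) = 0) (t : Q) :
    aeval ![ξ + t, ζ + s * t] h = 0 := by
  have key : tay ξ ζ s (emb3 k h) = 0 := by
    have hch : CharP Q p := charP_of_injective_algebraMap (algebraMap k Q).injective p
    ext j
    rw [Polynomial.coeff_zero]
    by_cases hj : j < p
    · have e : Polynomial.eval 0 (Polynomial.derivative^[j] (tay ξ ζ s (emb3 k h))) = 0 := by
        rw [tay_iter, tay_eval]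
        simp only [add_zero, mul_zero]
        obtain ⟨n, a, b, hab⟩ := iterJ h hH j
        have := congrArg (aeval ![ξ, ζ, s]) hab
        simp only [map_mul, map_add, map_pow, aeval_emb, h0, derE_emb, aeval_X] at this
        have hs' : aeval ![ξ, ζ] (pderiv 0 h) + (![ξ, ζ, s] 2) * aeval ![ξ, ζ] (pderiv 1 h) = 0 := hs
        rw [hs'] at this
        simp only [zero_mul, add_zero] at this
        exact (mul_eq_zero.mp this).resolve_left (pow_ne_zero _ h1)
      rw [← Polynomial.coeff_zero_eq_eval_zero, Polynomial.coeff_iterate_derivative] at e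
      simp only [zero_add, Nat.descFactorial_self, nsmul_eq_mul] at e
      refine (mul_eq_zero.mp e).resolve_left ?_
      intro hh
      rw [CharP.cast_eq_zero_iff Q p, (Fact.out : p.Prime).dvd_factorial] at hh
      omega
    · apply Polynomial.coeff_eq_zero_of_natDegree_lt
      have : tay ξ ζ s (emb3 k h) = aeval ![Polynomial.C ξ + Polynomial.X, Polynomial.C ζ + Polynomial.C s * Polynomial.X] h := by
        clear h0 h1 hs hdeg hH
        induction h using MvPolynomial.induction_on with
        | C a => simp [tay, emb3]
        | add f g hf hg => simp only [map_add, hf, hg]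
        | mul_X f i hf =>
          simp only [map_mul, hf]
          fin_cases i <;> simp [tay, emb3]
      rw [this]
      refine lt_of_le_of_lt (natDegree_aeval_le _ ?_ h) (by omega)
      intro i
      fin_cases i
      · simp
      · simp; compute_degree
  have := tay_eval ξ ζ s t (emb3 k h)
  rw [key, aeval_emb] at this
  simpa using this.symm
end Planar

open Finset

section Planar2
open MvPolynomial

variable {k : Type*} [Field k]

/-- restriction to vertical line -/
noncomputable def vres (a : k) : MvPolynomial (Fin 2) k →ₐ[k] Polynomial k :=
  aeval ![Polynomial.C a, Polynomial.X]

lemma vres_dvd (a : k) (h : MvPolynomial (Fin 2) k) :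
    (X 0 - C a) ∣ h - Polynomial.aeval (X 1 : MvPolynomial (Fin 2) k) (vres a h) := by
  induction h using MvPolynomial.induction_on with
  | C c => simp [vres, MvPolynomial.algebraMap_eq]
  | add f g hf hg =>
    simp only [map_add]
    convert dvd_add hf hg using 1
    ring
  | mul_X f i hf =>
    simp only [map_mul]
    fin_cases i
    · simp only [vres, aeval_X, Fin.zero_eta, Matrix.cons_val_zero, Polynomial.aeval_C, MvPolynomial.algebraMap_eq] at hf ⊢
      set g := Polynomial.aeval (X 1 : MvPolynomial (Fin 2) k) (vres a f) with hg
      have : f * X 0 - g * C a = (f - g) * X 0 + g * (X 0 - C a) := by ring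
      change _ ∣ f * X 0 - g * C a
      rw [this]
      exact dvd_add (Dvd.dvd.mul_right hf _) (Dvd.intro_left _ rfl)
    · have e : Polynomial.aeval (X 1 : MvPolynomial (Fin 2) k) (vres a (X 1)) = X 1 := by simp [vres]
      change _ ∣ f * X 1 - _ * Polynomial.aeval (X 1 : MvPolynomial (Fin 2) k) (vres a (X 1))
      rw [e, ← sub_mul]
      exact Dvd.dvd.mul_right hf _

lemma vres_eval (a b : k) (h : MvPolynomial (Fin 2) k) :
    Polynomial.eval b (vres a h) = eval ![a, b] h := by
  induction h using MvPolynomial.induction_on with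
  | C c => simp [vres]
  | add f g hf hg => simp only [map_add, Polynomial.eval_add, hf, hg]
  | mul_X f i hf =>
    simp only [map_mul, Polynomial.eval_mul, hf]
    fin_cases i <;> simp [vres]

lemma vres_aeval {Q : Type*} [Field Q] [Algebra k Q] (a : k) (w : Q) (h : MvPolynomial (Fin 2) k) :
    Polynomial.aeval w (vres a h) = aeval ![algebraMap k Q a, w] h := by
  induction h using MvPolynomial.induction_on with
  | C c => simp [vres]
  | add f g hf hg => simp only [map_add, hf, hg]
  | mul_X f i hf =>
    simp only [map_mul, hf]
    fin_cases i <;> simp [vres]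

lemma vres_deriv (a : k) (h : MvPolynomial (Fin 2) k) :
    Polynomial.derivative (vres a h) = vres a (pderiv 1 h) := by
  induction h using MvPolynomial.induction_on with
  | C c => simp [vres]
  | add f g hf hg => simp only [map_add, hf, hg]
  | mul_X f i hf =>
    simp only [map_mul, Polynomial.derivative_mul, Derivation.leibniz, hf, smul_eq_mul, map_add]
    fin_cases i <;> simp [vres, pderiv_X] <;> ring

lemma not_dvd_pderiv (p : ℕ) [Fact p.Prime] [CharP k p] (h : MvPolynomial (Fin 2) k)
    (hdeg : h.totalDegree < p) (a b : k) (hab : eval ![a, b] h = 0) (hne : vres a h ≠ 0) :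
    ¬ h ∣ pderiv 1 h := by
  intro hd
  have h1 : vres a h ∣ Polynomial.derivative (vres a h) := by
    rw [vres_deriv]; exact map_dvd (vres a) hd
  have hd2 : (vres a h).natDegree < p := by
    refine lt_of_le_of_lt (natDegree_aeval_le _ ?_ h) hdeg
    intro i; fin_cases i <;> simp
  have hpos : 0 < (vres a h).natDegree := by
    rw [Nat.pos_iff_ne_zero]
    intro h0
    rw [Polynomial.natDegree_eq_zero] at h0
    obtain ⟨c, hc⟩ := h0
    have := vres_eval a b h
    rw [hab, ← hc, Polynomial.eval_C] at this
    rw [← hc, this] at hne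
    simp at hne
  have hne' : Polynomial.derivative (vres a h) ≠ 0 := by
    intro h0
    have := congrArg (fun q => Polynomial.coeff q ((vres a h).natDegree - 1)) h0
    simp only [Polynomial.coeff_derivative, Polynomial.coeff_zero] at this
    rw [Nat.sub_add_cancel hpos] at this
    rcases mul_eq_zero.mp this with h2 | h2
    · exact hne (Polynomial.leadingCoeff_eq_zero.mp h2)
    · have h3 : (((vres a h).natDegree : ℕ) : k) = 0 := by
        rw [← Nat.sub_add_cancel hpos]; push_cast; exact h2
      rw [CharP.cast_eq_zero_iff k p] at h3
      exact absurd (Nat.le_of_dvd hpos h3) (by omega)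
  have := Polynomial.natDegree_le_of_dvd h1 hne'
  have h2 := Polynomial.natDegree_derivative_lt (p := vres a h) (by omega)
  omega

lemma lying {Q : Type*} [Field Q] [Algebra k Q] [Algebra (MvPolynomial (Fin 2) k) Q]
    [IsScalarTower k (MvPolynomial (Fin 2) k) Q] (a b : k)
    (hker : ∀ g : MvPolynomial (Fin 2) k, algebraMap _ Q g = 0 → eval ![a, b] g = 0)
    (w s : Q) (hw : IsIntegral k w) (hs : IsIntegral k s)
    (h : w = algebraMap _ Q (X 1 : MvPolynomial (Fin 2) k) +
      s * (algebraMap k Q a - algebraMap _ Q (X 0 : MvPolynomial (Fin 2) k))) :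
    w = algebraMap k Q b := by
  by_contra hne
  let A := MvPolynomial (Fin 2) k
  let S := integralClosure A Q
  have hint : ∀ x : Q, IsIntegral k x → x ∈ S := fun x hx => hx.tower_top
  let P : Ideal A := RingHom.ker (eval ![a, b])
  have : P.IsPrime := RingHom.ker_isPrime _
  obtain ⟨P', hP', hc⟩ := Ideal.exists_ideal_over_prime_of_isIntegral_of_isDomain (S := S) P (by
    intro g hg
    rw [RingHom.mem_ker] at hg ⊢
    apply hker
    have := congrArg (algebraMap S Q) hg
    simpa [← IsScalarTower.algebraMap_apply] using this)
  have hbQ : IsIntegral k (algebraMap k Q b) := isIntegral_algebraMap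
  have hwb : IsIntegral k (w - algebraMap k Q b) := hw.sub hbQ
  have hinv : IsIntegral k (w - algebraMap k Q b)⁻¹ := hwb.inv
  have m0 : (algebraMap A S (X 0 - C a)) ∈ P' := by
    rw [← Ideal.mem_comap, hc, RingHom.mem_ker, map_sub, eval_X, eval_C]; simp
  have m1 : (algebraMap A S (X 1 - C b)) ∈ P' := by
    rw [← Ideal.mem_comap, hc, RingHom.mem_ker, map_sub, eval_X, eval_C]; simp
  have m2 : (⟨w - algebraMap k Q b, hint _ hwb⟩ : S) ∈ P' := by
    have : (⟨w - algebraMap k Q b, hint _ hwb⟩ : S) =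
        algebraMap A S (X 1 - C b) - ⟨s, hint _ hs⟩ * algebraMap A S (X 0 - C a) := by
      apply Subtype.ext
      have e : ∀ g : A, ((algebraMap A S g : S) : Q) = algebraMap A Q g := fun g => rfl
      have e2 : ∀ c : k, algebraMap A Q (C c) = algebraMap k Q c := fun c => by
        rw [IsScalarTower.algebraMap_apply k A Q]; rfl
      push_cast
      rw [e2, e2]
      rw [h]; ring
    rw [this]
    exact sub_mem m1 (P'.mul_mem_left _ m0)
  apply hP'.ne_top
  rw [Ideal.eq_top_iff_one]
  have : (1 : S) = ⟨(w - algebraMap k Q b)⁻¹, hint _ hinv⟩ * ⟨w - algebraMap k Q b, hint _ hwb⟩ := by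
    apply Subtype.ext
    change (1:Q) = (w - algebraMap k Q b)⁻¹ * (w - algebraMap k Q b)
    rw [inv_mul_cancel₀ (sub_ne_zero.mpr hne)]
  rw [this]
  exact P'.mul_mem_left _ m2

theorem flex_collinear (p : ℕ) [Fact p.Prime] [CharP k p] (h : MvPolynomial (Fin 2) k)
    (hp : Prime h) (hdeg : h.totalDegree < p) (hH : h ∣ flexP 0 1 h) :
    ∃ u v w : k, (u ≠ 0 ∨ v ≠ 0) ∧ ∀ a b : k, eval ![a, b] h = 0 → u * a + v * b = w := by
  by_cases hv : ∃ a : k, vres a h = 0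
  · obtain ⟨a, ha⟩ := hv
    refine ⟨1, 0, a, Or.inl one_ne_zero, ?_⟩
    have hd := vres_dvd a h
    rw [ha] at hd
    simp only [map_zero, sub_zero] at hd
    obtain ⟨c, hc⟩ := hd
    intro x y hxy
    rcases hp.irreducible.isUnit_or_isUnit hc with hu | hu
    · have := hu.map (eval ![a, 0])
      simp at this
    · have h2 := hu.map (eval ![x, y])
      rw [hc] at hxy
      simp only [map_mul, map_sub, eval_X, eval_C, mul_eq_zero] at hxy
      rcases hxy with h3 | h3
      · simp at h3; simp; linear_combination h3
      · rw [h3] at h2; simp at h2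
  by_cases hz : ∃ a b : k, eval ![a, b] h = 0
  swap
  · refine ⟨1, 0, 0, Or.inl one_ne_zero, fun a b hab => absurd ⟨a, b, hab⟩ hz⟩
  obtain ⟨a0, b0, hab0⟩ := hz
  push Not at hv
  have hnd := not_dvd_pderiv p h hdeg a0 b0 hab0 (hv a0)
  let A := MvPolynomial (Fin 2) k
  have hprime : (Ideal.span {h} : Ideal A).IsPrime := (Ideal.span_singleton_prime hp.ne_zero).mpr hp
  let Q := FractionRing (A ⧸ (Ideal.span {h} : Ideal A))
  have hkerQ : ∀ g : A, algebraMap A Q g = 0 ↔ h ∣ g := by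
    intro g
    rw [IsScalarTower.algebraMap_apply A (A ⧸ (Ideal.span {h} : Ideal A)) Q]
    rw [FaithfulSMul.algebraMap_eq_zero_iff]
    rw [Ideal.Quotient.algebraMap_eq, Ideal.Quotient.eq_zero_iff_mem, Ideal.mem_span_singleton]
  set ξ : Q := algebraMap A Q (X 0) with hξ
  set ζ : Q := algebraMap A Q (X 1) with hζ
  have hae : ∀ g : A, aeval ![ξ, ζ] g = algebraMap A Q g := by
    intro g
    induction g using MvPolynomial.induction_on with
    | C c => simp only [aeval_C]; rw [IsScalarTower.algebraMap_apply k A Q]; rfl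
    | add f g hf hg => simp only [map_add, hf, hg]
    | mul_X f i hf =>
      simp only [map_mul, hf]
      fin_cases i <;> simp [ξ, ζ]
  have hu : aeval ![ξ, ζ] (pderiv 1 h) ≠ 0 := by
    rw [hae, Ne, hkerQ]; exact hnd
  have h0 : aeval ![ξ, ζ] h = 0 := by rw [hae, hkerQ]
  set s : Q := - aeval ![ξ, ζ] (pderiv 0 h) / aeval ![ξ, ζ] (pderiv 1 h) with hs
  have hl := line_in p h hH hdeg ξ ζ s h0 hu (by rw [hs, div_mul_cancel₀ _ hu, add_neg_cancel])
  have hint : ∀ a : k, IsIntegral k (ζ + s * (algebraMap k Q a - ξ)) := by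
    intro a
    have h1 := hl (algebraMap k Q a - ξ)
    rw [add_sub_cancel, ← vres_aeval] at h1
    exact IsAlgebraic.isIntegral ⟨vres a h, hv a, h1⟩
  have hsint : IsIntegral k s := by
    have := (hint 1).sub (hint 0)
    have e : ζ + s * (algebraMap k Q 1 - ξ) - (ζ + s * (algebraMap k Q 0 - ξ)) = s := by
      rw [map_one, map_zero]
      ring
    rw [e] at this
    exact this
  have hfin : ∀ a b : k, eval ![a, b] h = 0 → ζ + s * (algebraMap k Q a - ξ) = algebraMap k Q b := by
    intro a b hab
    refine lying a b ?_ _ s (hint a) hsint rfl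
    intro g hg
    rw [hkerQ] at hg
    obtain ⟨c, rfl⟩ := hg
    simp [hab]
  by_cases hall : ∀ a b : k, eval ![a, b] h = 0 → a = a0
  · exact ⟨1, 0, a0, Or.inl one_ne_zero, fun a b hab => by rw [hall a b hab]; ring⟩
  push Not at hall
  obtain ⟨a1, b1, hab1, hne⟩ := hall
  set t : k := (b1 - b0) / (a1 - a0) with ht
  have hst : s = algebraMap k Q t := by
    have e1 := hfin a1 b1 hab1
    have e0 := hfin a0 b0 hab0
    have hne' : algebraMap k Q a1 - algebraMap k Q a0 ≠ 0 := by
      rw [← map_sub, Ne, FaithfulSMul.algebraMap_eq_zero_iff]; exact sub_ne_zero.mpr hne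
    rw [ht, map_div₀, map_sub, map_sub, eq_div_iff hne']
    linear_combination e1 - e0
  refine ⟨-t, 1, b0 - t * a0, Or.inr one_ne_zero, ?_⟩
  intro a b hab
  have e1 := hfin a b hab
  have e0 := hfin a0 b0 hab0
  apply (algebraMap k Q).injective
  simp only [map_add, map_mul, map_neg, map_sub, map_one]
  rw [← hst]
  linear_combination e0 - e1
end Planar2

open Finset

section Trans
open MvPolynomial

variable {K : Type*} [Field K]

/-- restriction to a line of family 1 -/
noncomputable def rl1 (x m c : K) : MvPolynomial (Option (Fin 2)) K →ₐ[K] Polynomial K :=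
  aeval (fun o => o.elim Polynomial.X ![Polynomial.C x, Polynomial.C m * Polynomial.X + Polynomial.C c])

/-- restriction to a line of family 2 -/
noncomputable def rl2 (y m c : K) : MvPolynomial (Option (Fin 2)) K →ₐ[K] Polynomial K :=
  aeval (fun o => o.elim (Polynomial.C y) ![Polynomial.X, Polynomial.C m * Polynomial.X + Polynomial.C c])

/-- generic slice -/
noncomputable def gsl (K : Type*) [Field K] :
    MvPolynomial (Option (Fin 2)) K →ₐ[K] MvPolynomial (Fin 2) (FractionRing (Polynomial K)) :=
  aeval (fun o => o.elim (C (algebraMap (Polynomial K) _ Polynomial.X)) (fun i => X i))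

lemma gsl_eq (h : MvPolynomial (Option (Fin 2)) K) :
    gsl K h = map (algebraMap (Polynomial K) (FractionRing (Polynomial K)))
      (optionEquivRight K (Fin 2) h) := by
  induction h using MvPolynomial.induction_on with
  | C a =>
    simp only [gsl, aeval_C, optionEquivRight_C, map_C]
    rw [IsScalarTower.algebraMap_apply K (Polynomial K) (MvPolynomial (Fin 2) (FractionRing (Polynomial K)))]
    rw [MvPolynomial.algebraMap_apply]
    rfl
  | add f g hf hg => simp only [map_add, hf, hg]
  | mul_X f i hf =>
    simp only [map_mul, hf]
    congr 1
    rcases i with _ | i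
    · simp [gsl, optionEquivRight_X_none]
    · simp [gsl, optionEquivRight_X_some]

lemma gsl_pderiv (i : Fin 2) (h : MvPolynomial (Option (Fin 2)) K) :
    gsl K (pderiv (some i) h) = pderiv i (gsl K h) := by
  induction h using MvPolynomial.induction_on with
  | C a =>
    simp only [gsl, pderiv_C, map_zero, aeval_C]
    rw [IsScalarTower.algebraMap_apply K (FractionRing (Polynomial K)), MvPolynomial.algebraMap_eq, pderiv_C]
  | add f g hf hg => simp only [map_add, hf, hg]
  | mul_X f j hf =>
    simp only [map_mul, map_add, Derivation.leibniz, hf, smul_eq_mul]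
    congr 2
    rcases j with _ | j
    · simp [gsl, pderiv_X]
    · by_cases hij : i = j
      · subst hij; simp [gsl, pderiv_X]
      · simp [gsl, pderiv_X, Pi.single_apply, Ne.symm hij]

lemma gsl_flex (h : MvPolynomial (Option (Fin 2)) K) :
    gsl K (flexP (some 0) (some 1) h) = flexP 0 1 (gsl K h) := by
  simp only [flexP, map_add, map_sub, map_mul, map_pow, gsl_pderiv, map_ofNat]

lemma gsl_deg (h : MvPolynomial (Option (Fin 2)) K) : (gsl K h).totalDegree ≤ h.totalDegree := by
  rw [gsl, aeval_def, eval₂_eq]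
  refine totalDegree_finsetSum_le ?_
  intro d hd
  refine (totalDegree_mul _ _).trans ?_
  have : (algebraMap K (MvPolynomial (Fin 2) (FractionRing (Polynomial K))) (coeff d h)).totalDegree = 0 := by
    rw [IsScalarTower.algebraMap_apply K (FractionRing (Polynomial K)), MvPolynomial.algebraMap_eq, totalDegree_C]
  rw [this, zero_add]
  refine (totalDegree_finsetProd _ _).trans ?_
  refine le_trans ?_ (le_totalDegree hd)
  rw [Finsupp.sum]
  refine Finset.sum_le_sum fun i _ => ?_
  refine (totalDegree_pow _ _).trans ?_
  calc _ ≤ d i * 1 := Nat.mul_le_mul_left _ (by rcases i with _ | i <;> simp [totalDegree_X])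
    _ = _ := mul_one _

lemma gsl_eval (x m c : K) (h : MvPolynomial (Option (Fin 2)) K) :
    eval ![algebraMap (Polynomial K) (FractionRing (Polynomial K)) (Polynomial.C x),
      algebraMap (Polynomial K) (FractionRing (Polynomial K)) (Polynomial.C m * Polynomial.X + Polynomial.C c)] (gsl K h)
      = algebraMap (Polynomial K) (FractionRing (Polynomial K)) (rl1 x m c h) := by
  induction h using MvPolynomial.induction_on with
  | C a =>
    simp only [gsl, rl1, aeval_C]
    rw [IsScalarTower.algebraMap_apply K (FractionRing (Polynomial K)), MvPolynomial.algebraMap_eq, eval_C,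
      ← IsScalarTower.algebraMap_apply]
  | add f g hf hg => rw [map_add (gsl K), map_add (eval _), map_add (rl1 x m c), hf, hg, map_add (algebraMap _ _)]
  | mul_X f j hf =>
    rw [map_mul (gsl K), map_mul (eval _), map_mul (rl1 x m c), map_mul (algebraMap _ _), hf]
    congr 1
    rcases j with _ | j
    · simp [gsl, rl1]
    · fin_cases j <;> simp [gsl, rl1]

lemma rl1_const (x m c : K) (q : Polynomial K) : rl1 x m c (Polynomial.aeval (X none) q) = q := by
  induction q using Polynomial.induction_on with
  | C a => simp [rl1, Polynomial.algebraMap_apply]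
  | add f g hf hg => simp only [map_add, hf, hg]
  | monomial n a h => simp [rl1]

lemma oer_const (q : Polynomial K) :
    optionEquivRight K (Fin 2) (Polynomial.aeval (X none) q) = C q := by
  have : ((optionEquivRight K (Fin 2)).toAlgHom.comp (Polynomial.aeval (X none))) =
      (Algebra.ofId (Polynomial K) (MvPolynomial (Fin 2) (Polynomial K))).restrictScalars K := by
    apply Polynomial.algHom_ext
    simp [optionEquivRight_X_none, Algebra.ofId_apply, MvPolynomial.algebraMap_eq]
  exact DFunLike.congr_fun this q

lemma gsl_prime (h : MvPolynomial (Option (Fin 2)) K) (hp : Prime h)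
    (hc : ∀ q : Polynomial K, q ≠ 0 → ¬ h ∣ Polynomial.aeval (X none) q) : Prime (gsl K h) := by
  letI : Algebra (MvPolynomial (Fin 2) (Polynomial K)) (MvPolynomial (Fin 2) (FractionRing (Polynomial K))) :=
    MvPolynomial.algebraMvPolynomial
  let B := MvPolynomial (Fin 2) (Polynomial K)
  let Bk := MvPolynomial (Fin 2) (FractionRing (Polynomial K))
  let h' : B := optionEquivRight K (Fin 2) h
  have hp' : Prime h' := (MulEquiv.prime_iff (optionEquivRight K (Fin 2)).toMulEquiv).mpr hp
  have hI : (Ideal.span {h'} : Ideal B).IsPrime := (Ideal.span_singleton_prime hp'.ne_zero).mpr hp'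
  have hne : gsl K h ≠ 0 := by
    rw [gsl_eq, Ne, map_eq_zero_iff _ (map_injective _ (IsFractionRing.injective _ _))]; exact hp'.ne_zero
  rw [← Ideal.span_singleton_prime hne]
  have := IsLocalization.isPrime_of_isPrime_disjoint ((nonZeroDivisors (Polynomial K)).map (C (σ := Fin 2)))
    Bk (Ideal.span {h'}) hI (by
      rw [Set.disjoint_left]
      rintro _ ⟨q, hq, rfl⟩ hmem
      rw [SetLike.mem_coe, Ideal.mem_span_singleton] at hmem
      refine hc q (nonZeroDivisors.ne_zero hq) ?_
      have h2 := map_dvd (optionEquivRight K (Fin 2)).symm hmem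
      rw [show (optionEquivRight K (Fin 2)).symm h' = h from
        (optionEquivRight K (Fin 2)).symm_apply_apply h, ← oer_const] at h2
      rwa [AlgEquiv.symm_apply_apply] at h2)
  rw [Ideal.map_span, Set.image_singleton] at this
  rw [gsl_eq]
  exact this

theorem flex_family (p : ℕ) [Fact p.Prime] [CharP K p] (h : MvPolynomial (Option (Fin 2)) K)
    (hp : Prime h) (hdeg : h.totalDegree < p) (hH : h ∣ flexP (some 0) (some 1) h) :
    (∃ x0 : K, ∀ x m c : K, rl1 x m c h = 0 → x = x0) ∨
    (∃ α β γ δ : K, ∀ x m c : K, rl1 x m c h = 0 → m = α * x + γ ∧ c = β * x + δ) := by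
  by_cases hc : ∀ q : Polynomial K, q ≠ 0 → ¬ h ∣ Polynomial.aeval (X none) q
  swap
  · push Not at hc
    obtain ⟨q, hq, hd⟩ := hc
    left
    refine ⟨0, fun x m c hx => absurd ?_ hq⟩
    have := map_dvd (rl1 x m c) hd
    rw [hx, rl1_const] at this
    exact zero_dvd_iff.mp this
  let k := FractionRing (Polynomial K)
  have : CharP k p := charP_of_injective_algebraMap (algebraMap K k).injective p
  obtain ⟨u, v, w, huv, hl⟩ := flex_collinear p (gsl K h) (gsl_prime h hp hc)
    (lt_of_le_of_lt (gsl_deg h) hdeg) (by rw [← gsl_flex]; exact map_dvd _ hH)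
  have hl' : ∀ x m c : K, rl1 x m c h = 0 → u * algebraMap (Polynomial K) k (Polynomial.C x)
      + v * algebraMap (Polynomial K) k (Polynomial.C m * Polynomial.X + Polynomial.C c) = w := by
    intro x m c hx
    apply hl
    rw [gsl_eval, hx, map_zero]
  have hinj : Function.Injective (algebraMap (Polynomial K) k) := IsFractionRing.injective _ _
  by_cases hall : ∃ x0 : K, ∀ x m c : K, rl1 x m c h = 0 → x = x0
  · exact Or.inl hall
  right
  push Not at hall
  obtain ⟨x1, m1, c1, h1, -⟩ := hall 0
  obtain ⟨x2, m2, c2, h2, hne⟩ := hall x1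
  have e1 := hl' _ _ _ h1
  have e2 := hl' _ _ _ h2
  have hv : v ≠ 0 := by
    rintro rfl
    have hu : u ≠ 0 := by simpa using huv
    simp only [zero_mul, add_zero] at e1 e2
    have := mul_left_cancel₀ hu (e1.trans e2.symm)
    exact hne (Polynomial.C_injective (hinj this)).symm
  have hd : x2 - x1 ≠ 0 := sub_ne_zero.mpr hne
  refine ⟨(m2 - m1)/(x2-x1), (c2 - c1)/(x2-x1), m1 - (m2 - m1)/(x2-x1)*x1, c1 - (c2-c1)/(x2-x1)*x1, ?_⟩
  intro x m c hx
  have e := hl' _ _ _ hx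
  have key : (Polynomial.C (x2 - x1)) * (Polynomial.C (m - m1) * Polynomial.X + Polynomial.C (c - c1)) =
      (Polynomial.C (x - x1)) * (Polynomial.C (m2 - m1) * Polynomial.X + Polynomial.C (c2 - c1)) := by
    apply hinj
    apply mul_left_cancel₀ hv
    simp only [map_mul, map_add, map_sub] at e e1 e2 ⊢
    linear_combination (algebraMap (Polynomial K) k (Polynomial.C x2) - algebraMap (Polynomial K) k (Polynomial.C x1)) * (e - e1)
     - (algebraMap (Polynomial K) k (Polynomial.C x) - algebraMap (Polynomial K) k (Polynomial.C x1)) * (e2 - e1)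
  have k1 := congrArg (fun q => Polynomial.coeff q 1) key
  have k0 := congrArg (fun q => Polynomial.coeff q 0) key
  simp [Polynomial.coeff_C, -map_sub] at k1 k0
  constructor
  · field_simp
    linear_combination k1
  · field_simp
    linear_combination k0
end Trans

open Finset

section Bez
open MvPolynomial

variable {K : Type*} [Field K]

lemma finrank_rtd (n : ℕ) : 6 * Module.finrank K (restrictTotalDegree (Option (Fin 2)) K n) =
    (n+1)*(n+2)*(n+3) := by
  have h1 : Module.finrank K (restrictTotalDegree (Option (Fin 2)) K n) =
      Nat.card {d : Option (Fin 2) →₀ ℕ | (d.sum fun _ e => e) ≤ n} :=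
    Module.finrank_eq_nat_card_basis (basisRestrictSupport K _)
  have h2 : {d : Option (Fin 2) →₀ ℕ | (d.sum fun _ e => e) ≤ n} =
      ((Finset.range (n+1)).biUnion (fun i => Finset.finsuppAntidiag (Finset.univ : Finset (Option (Fin 2))) i) :
        Finset (Option (Fin 2) →₀ ℕ)) := by
    ext d
    simp only [Set.mem_setOf_eq, Finset.coe_biUnion, Set.mem_iUnion, Finset.mem_coe, Finset.mem_range,
      Finset.mem_finsuppAntidiag']
    constructor
    · intro h
      exact ⟨_, by omega, rfl, Finset.subset_univ _⟩
    · rintro ⟨i, hi, h, -⟩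
      change d.sum (fun _ e => e) = i at h
      omega
  rw [h1, h2, Nat.card_coe_set_eq, Set.ncard_coe_finset, Finset.card_biUnion]
  · simp only [Finset.card_finsuppAntidiag_nat_eq_choose, Finset.card_univ, Fintype.card_option, Fintype.card_fin]
    clear h1 h2
    induction n with
    | zero => simp
    | succ n ih =>
      rw [Finset.sum_range_succ, mul_add, ih]
      rw [show 2 + 1 + (n+1) - 1 = (n+1) + 2 by omega, Nat.choose_symm_add]
      have : (n+1+2).choose 2 * 2 = (n+1+2)*(n+2) := by
        rw [Nat.choose_two_right, Nat.div_mul_cancel]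
        · rfl
        · exact (Nat.even_mul_pred_self _).two_dvd
      nlinarith
  · intro i _ j _ hij
    rw [Function.onFun, Finset.disjoint_left]
    intro d hd hd'
    rw [Finset.mem_finsuppAntidiag] at hd hd'
    exact hij (hd.1.symm.trans hd'.1)

lemma finrank_map_mul (P : MvPolynomial (Option (Fin 2)) K) (hP : P ≠ 0)
    (V : Submodule K (MvPolynomial (Option (Fin 2)) K)) :
    Module.finrank K (V.map (LinearMap.mulLeft K P)) = Module.finrank K V :=
  (LinearEquiv.finrank_eq (Submodule.equivMapOfInjective (LinearMap.mulLeft K P)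
    (fun a b h => mul_left_cancel₀ hP h) V)).symm

/-- codimension bound -/
lemma codim_bound (h G : MvPolynomial (Option (Fin 2)) K) (hp : Prime h) (hG : ¬ h ∣ G) (n : ℕ)
    {ι : Type*} [Fintype ι]
    (ev : MvPolynomial (Option (Fin 2)) K →ₗ[K] (ι → K))
    (hev : ∀ f, ∃ P, P.totalDegree ≤ n + h.totalDegree + G.totalDegree ∧ ev P = f)
    (hh : ∀ u, ev (h * u) = 0) (hg : ∀ u, ev (G * u) = 0) :
    Fintype.card ι ≤ h.totalDegree * G.totalDegree * (n + h.totalDegree + G.totalDegree + 2) := by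
  set a := h.totalDegree with ha
  set b := G.totalDegree with hb
  have hG0 : G ≠ 0 := by rintro rfl; exact hG (dvd_zero _)
  let V := restrictTotalDegree (Option (Fin 2)) K
  let W1 := (V (n+b)).map (LinearMap.mulLeft K h)
  let W2 := (V (n+a)).map (LinearMap.mulLeft K G)
  have r1 : Module.finrank K W1 = Module.finrank K (V (n+b)) := finrank_map_mul _ hp.ne_zero _
  have r2 : Module.finrank K W2 = Module.finrank K (V (n+a)) := finrank_map_mul _ hG0 _
  have r3 : Module.finrank K (W1 ⊓ W2 : Submodule K _) ≤ Module.finrank K (V n) := by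
    rw [← finrank_map_mul (h * G) (mul_ne_zero hp.ne_zero hG0) (V n)]
    apply Submodule.finrank_mono
    rintro w ⟨⟨u, hu, rfl⟩, ⟨v, hv, hvw⟩⟩
    simp only [LinearMap.mulLeft_apply] at hvw
    have hd : h ∣ v := (hp.dvd_or_dvd (show h ∣ G * v from ⟨u, hvw⟩)).resolve_left hG
    obtain ⟨v', rfl⟩ := hd
    refine ⟨v', ?_, ?_⟩
    · rw [SetLike.mem_coe, mem_restrictTotalDegree] at hv ⊢
      by_cases h0 : v' = 0
      · simp [h0]
      · rw [totalDegree_mul_of_isDomain hp.ne_zero h0] at hv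
        omega
    · simp only [LinearMap.mulLeft_apply]
      rw [← hvw]; ring
  have r4 := Submodule.finrank_sup_add_finrank_inf_eq W1 W2
  have hW : W1 ⊔ W2 ≤ V (n + a + b) := by
    refine sup_le ?_ ?_
    · rintro _ ⟨u, hu, rfl⟩
      rw [SetLike.mem_coe, mem_restrictTotalDegree] at hu
      rw [mem_restrictTotalDegree, LinearMap.mulLeft_apply]
      refine (totalDegree_mul _ _).trans ?_
      omega
    · rintro _ ⟨u, hu, rfl⟩
      rw [SetLike.mem_coe, mem_restrictTotalDegree] at hu
      rw [mem_restrictTotalDegree, LinearMap.mulLeft_apply]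
      refine (totalDegree_mul _ _).trans ?_
      omega
  have hWk : W1 ⊔ W2 ≤ LinearMap.ker ev := by
    refine sup_le ?_ ?_
    · rintro _ ⟨u, hu, rfl⟩; exact hh u
    · rintro _ ⟨u, hu, rfl⟩; exact hg u
  have r5 := LinearMap.finrank_range_add_finrank_ker (ev.domRestrict (V (n+a+b)))
  have r6 : LinearMap.range (ev.domRestrict (V (n+a+b))) = ⊤ := by
    rw [LinearMap.range_eq_top]
    intro f
    obtain ⟨P, hP, rfl⟩ := hev f
    exact ⟨⟨P, (mem_restrictTotalDegree _ _ _).mpr hP⟩, rfl⟩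
  rw [r6, finrank_top, Module.finrank_fintype_fun_eq_card] at r5
  have r7 : Module.finrank K (W1 ⊔ W2 : Submodule K _) ≤
      Module.finrank K (LinearMap.ker (ev.domRestrict (V (n+a+b)))) := by
    rw [← (Submodule.comapSubtypeEquivOfLe hW).finrank_eq]
    apply Submodule.finrank_mono
    intro x hx
    exact hWk hx
  have s1 := finrank_rtd (K := K) (n + a + b)
  have s2 := finrank_rtd (K := K) (n + b)
  have s3 := finrank_rtd (K := K) (n + a)
  have s4 := finrank_rtd (K := K) n
  change 6 * Module.finrank K (V _) = _ at s1 s2 s3 s4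
  have : 6 * Fintype.card ι + (n+b+1)*(n+b+2)*(n+b+3) + (n+a+1)*(n+a+2)*(n+a+3) ≤
     (n+a+b+1)*(n+a+b+2)*(n+a+b+3) + (n+1)*(n+2)*(n+3) := by omega
  have h6 : 6 * Fintype.card ι ≤ 6 * (a * b * (n + a + b + 2)) := by
    nlinarith [Nat.zero_le (a*b*(a+b))]
  omega

lemma ev_surj (T : Finset (K × K × K)) (hT : ∀ l ∈ T, ∀ l' ∈ T, l.1 = l'.1 → l.2.1 = l'.2.1)
    (X0 : Finset K) (l : K × K × K) (hl : l ∈ T) (x : K) (hx : x ∈ X0) :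
    ∃ P : MvPolynomial (Option (Fin 2)) K, P.totalDegree ≤ T.card + X0.card ∧
      Polynomial.eval x (rl2 l.1 l.2.1 l.2.2 P) = 1 ∧
      ∀ l' ∈ T, ∀ x' ∈ X0, (l', x') ≠ (l, x) → Polynomial.eval x' (rl2 l'.1 l'.2.1 l'.2.2 P) = 0 := by
  classical
  let F : (K × K × K) → MvPolynomial (Option (Fin 2)) K := fun l' =>
    if l.1 = l'.1 then X (some 1) - C l'.2.1 * X (some 0) - C l'.2.2 else X none - C l'.1
  have hF : ∀ l', (F l').totalDegree ≤ 1 := by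
    intro l'
    dsimp only [F]
    split_ifs
    · refine (totalDegree_sub _ _).trans (max_le ((totalDegree_sub _ _).trans (max_le ?_ ?_)) ?_)
      · rw [totalDegree_X]
      · refine (totalDegree_mul _ _).trans ?_
        rw [totalDegree_X, totalDegree_C]
      · rw [totalDegree_C]; omega
    · refine (totalDegree_sub _ _).trans (max_le ?_ ?_)
      · rw [totalDegree_X]
      · rw [totalDegree_C]; omega
  let P0 : MvPolynomial (Option (Fin 2)) K := (∏ l' ∈ T.erase l, F l') * ∏ x' ∈ X0.erase x, (X (some 0) - C x')
  have hP0 : P0.totalDegree ≤ T.card + X0.card := by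
    refine (totalDegree_mul _ _).trans (Nat.add_le_add ?_ ?_)
    · refine (totalDegree_finsetProd _ _).trans ((Finset.sum_le_card_nsmul _ _ 1 fun l' _ => hF l').trans ?_)
      rw [smul_eq_mul, mul_one]; exact Finset.card_le_card (Finset.erase_subset _ _)
    · refine (totalDegree_finsetProd _ _).trans ((Finset.sum_le_card_nsmul _ _ 1 fun x' _ => ?_).trans ?_)
      · refine (totalDegree_sub _ _).trans (max_le ?_ ?_)
        · rw [totalDegree_X]
        · rw [totalDegree_C]; omega
      rw [smul_eq_mul, mul_one]; exact Finset.card_le_card (Finset.erase_subset _ _)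
  have hne : Polynomial.eval x (rl2 l.1 l.2.1 l.2.2 P0) ≠ 0 := by
    simp only [P0, map_mul, map_prod, Polynomial.eval_mul, Polynomial.eval_prod]
    refine mul_ne_zero (Finset.prod_ne_zero_iff.mpr ?_) (Finset.prod_ne_zero_iff.mpr ?_)
    · intro l' hl'
      have h1 := Finset.mem_erase.mp hl'
      dsimp only [F]
      split_ifs with h
      · have hm := hT l hl l' h1.2 h
        simp [rl2, hm]
        intro hc
        apply h1.1
        ext
        · exact h.symm
        · exact hm.symm
        · linear_combination -hc
      · simpa [rl2, sub_eq_zero] using h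
    · intro x' hx'
      have h1 := Finset.mem_erase.mp hx'
      simpa [rl2, sub_eq_zero] using h1.1.symm
  refine ⟨C (Polynomial.eval x (rl2 l.1 l.2.1 l.2.2 P0))⁻¹ * P0, ?_, ?_, ?_⟩
  · refine (totalDegree_mul _ _).trans ?_
    rw [totalDegree_C]; omega
  · rw [map_mul, Polynomial.eval_mul]
    simp [rl2, aeval_C]
    exact inv_mul_cancel₀ hne
  · intro l' hl' x' hx' hn
    rw [map_mul, Polynomial.eval_mul]
    convert mul_zero _
    simp only [P0, map_mul, map_prod, Polynomial.eval_mul, Polynomial.eval_prod, mul_eq_zero]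
    by_cases hll : l' = l
    · right
      have hxx : x' ≠ x := by rintro rfl; exact hn (by rw [hll])
      refine Finset.prod_eq_zero (Finset.mem_erase.mpr ⟨hxx, hx'⟩) ?_
      simp [rl2]
    · left
      refine Finset.prod_eq_zero (Finset.mem_erase.mpr ⟨hll, hl'⟩) ?_
      dsimp only [F]
      split_ifs <;> simp [rl2]

theorem bezout_lines [Infinite K] (h G : MvPolynomial (Option (Fin 2)) K) (hp : Prime h) (hG : ¬ h ∣ G)
    (T : Finset (K × K × K)) (hT : ∀ l ∈ T, ∀ l' ∈ T, l.1 = l'.1 → l.2.1 = l'.2.1)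
    (h1 : ∀ l ∈ T, rl2 l.1 l.2.1 l.2.2 h = 0) (h2 : ∀ l ∈ T, rl2 l.1 l.2.1 l.2.2 G = 0) :
    T.card ≤ h.totalDegree * G.totalDegree := by
  classical
  set a := h.totalDegree with ha
  set b := G.totalDegree with hb
  obtain ⟨X0, hX0⟩ := Infinite.exists_subset_card_eq K (a * b * (T.card + 2) + 1 + a + b)
  let ev : MvPolynomial (Option (Fin 2)) K →ₗ[K] (T × X0 → K) :=
    LinearMap.pi fun i => ((Polynomial.aeval (i.2 : K)).comp (rl2 i.1.1.1 i.1.1.2.1 i.1.1.2.2)).toLinearMap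
  have hev : ∀ P i, ev P i = Polynomial.eval (i.2 : K) (rl2 i.1.1.1 i.1.1.2.1 i.1.1.2.2 P) := by
    intro P i
    simp [ev, Polynomial.coe_aeval_eq_eval]
  have := codim_bound h G hp hG (T.card + a * b * (T.card + 2) + 1) ev (by
    intro f
    choose P hP1 hP2 hP3 using fun i : T × X0 => ev_surj T hT X0 i.1.1 i.1.2 i.2.1 i.2.2
    refine ⟨∑ i, C (f i) * P i, ?_, ?_⟩
    · refine totalDegree_finsetSum_le fun i _ => (totalDegree_mul _ _).trans ?_
      have := hP1 i
      rw [totalDegree_C]; omega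
    · ext j
      rw [map_sum, Finset.sum_apply, Finset.sum_eq_single j]
      · rw [hev, map_mul, Polynomial.eval_mul, hP2]
        simp [rl2, aeval_C]
      · intro i _ hij
        rw [hev, map_mul, Polynomial.eval_mul, hP3 i j.1.1 j.1.2 j.2.1 j.2.2, mul_zero]
        intro hc
        apply hij
        rw [Prod.ext_iff] at hc
        exact (Prod.ext (Subtype.ext hc.1) (Subtype.ext hc.2)).symm
      · simp) (by
    intro u; ext i; rw [hev, map_mul, h1 _ i.1.2]; simp) (by
    intro u; ext i; rw [hev, map_mul, h2 _ i.1.2]; simp)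
  rw [Fintype.card_prod, Fintype.card_coe, Fintype.card_coe, hX0, ← ha, ← hb] at this
  by_contra hcon
  push Not at hcon
  set t := T.card
  set q := a * b
  have h3 : (q+1) * (q * (t + 2) + 1 + a + b) ≤ t * (q * (t + 2) + 1 + a + b) := Nat.mul_le_mul_right _ hcon
  nlinarith
end Bez

open Finset

section Cnt
open MvPolynomial

lemma totalDegree_pderiv_le' {K σ : Type*} [Field K] (i : σ) (h : MvPolynomial σ K) :
    (pderiv i h).totalDegree ≤ h.totalDegree := by
  conv_lhs => rw [h.as_sum, map_sum]
  refine totalDegree_finsetSum_le fun d hd => ?_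
  rw [pderiv_monomial]
  refine (totalDegree_monomial_le _ _).trans ?_
  refine le_trans ?_ (le_totalDegree hd)
  exact Finsupp.degree_mono (tsub_le_self)

lemma pderiv_comm' {K σ : Type*} [Field K] (i j : σ) (h : MvPolynomial σ K) :
    pderiv i (pderiv j h) = pderiv j (pderiv i h) := by
  classical
  have : ⁅pderiv (R := K) i, pderiv (R := K) j⁆ = 0 := by
    apply MvPolynomial.derivation_ext
    intro l
    rw [Derivation.commutator_apply, pderiv_X, pderiv_X]
    simp only [Pi.single_apply]
    split_ifs <;> simp
  have h2 := DFunLike.congr_fun this h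
  rw [Derivation.commutator_apply] at h2
  exact sub_eq_zero.mp h2

lemma flex_deg {K σ : Type*} [Field K] (i j : σ) (h : MvPolynomial σ K) :
    (flexP i j h).totalDegree ≤ 3 * h.totalDegree := by
  have e1 := fun i => totalDegree_pderiv_le' i h
  have e2 := fun i j => (totalDegree_pderiv_le' i (pderiv j h)).trans (e1 j)
  have p2 : ∀ i, ((pderiv i h)^2).totalDegree ≤ 2 * h.totalDegree := fun i =>
    (totalDegree_pow _ _).trans (Nat.mul_le_mul_left _ (e1 i))
  unfold flexP
  refine (totalDegree_add _ _).trans (max_le ((totalDegree_sub _ _).trans (max_le ?_ ?_)) ?_)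
  · refine (totalDegree_mul _ _).trans ?_
    have := e2 i i; have := p2 j; omega
  · have h2 : ((2 : MvPolynomial σ K)).totalDegree = 0 := by
      rw [show (2 : MvPolynomial σ K) = C 2 from (map_ofNat C 2).symm, totalDegree_C]
    refine (totalDegree_mul _ _).trans ?_
    have t1 := totalDegree_mul (2 * pderiv i (pderiv j h)) (pderiv i h)
    have t2 := totalDegree_mul 2 (pderiv i (pderiv j h))
    have := e2 i j; have := e1 i; have := e1 j
    omega
  · refine (totalDegree_mul _ _).trans ?_
    have := e2 j j; have := p2 i; omega

variable {K : Type*} [Field K]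

lemma rl2_der (y m c : K) (h : MvPolynomial (Option (Fin 2)) K) :
    Polynomial.derivative (rl2 y m c h) =
      rl2 y m c (pderiv (some 0) h) + Polynomial.C m * rl2 y m c (pderiv (some 1) h) := by
  induction h using MvPolynomial.induction_on with
  | C a => simp [rl2, aeval_C, Polynomial.algebraMap_apply]
  | add f g hf hg => simp only [map_add, hf, hg]; ring
  | mul_X f j hf =>
    simp only [map_mul, map_add, Derivation.leibniz, Polynomial.derivative_mul, hf, smul_eq_mul]
    rcases j with _ | j
    · simp [rl2, pderiv_X]; ring
    · fin_cases j <;> simp [rl2, pderiv_X, Pi.single_apply] <;> ring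

lemma rl2_flex (y m c : K) (h : MvPolynomial (Option (Fin 2)) K) (h0 : rl2 y m c h = 0) :
    rl2 y m c (flexP (some 0) (some 1) h) = 0 := by
  have d1 := rl2_der y m c h
  have d20 := rl2_der y m c (pderiv (some 0) h)
  have d21 := rl2_der y m c (pderiv (some 1) h)
  rw [h0, Polynomial.derivative_zero] at d1
  have d2 := congrArg Polynomial.derivative d1
  simp only [Polynomial.derivative_add, Polynomial.derivative_mul, Polynomial.derivative_C, zero_mul, zero_add,
    Polynomial.derivative_zero, d20, d21] at d2
  have comm : pderiv (some 1) (pderiv (some 0) h) = pderiv (some 0) (pderiv (some 1) h) := by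
    exact pderiv_comm' _ _ _
  rw [comm] at d2
  unfold flexP
  simp only [map_add, map_sub, map_mul, map_pow, map_ofNat]
  set A := rl2 y m c (pderiv (some 0) h)
  set B := rl2 y m c (pderiv (some 1) h)
  have hA : A = - Polynomial.C m * B := by linear_combination -d1
  rw [hA]
  linear_combination -B^2 * d2

/-- meeting relation: family 2 line `l`, family 1 line `g` -/
def meetL (l g : K × K × K) : Prop := l.2.1 * g.1 + l.2.2 = g.2.1 * l.1 + g.2.2

lemma rl_meet (l g : K × K × K) (hm : meetL l g) (h : MvPolynomial (Option (Fin 2)) K) :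
    Polynomial.eval l.1 (rl1 g.1 g.2.1 g.2.2 h) = Polynomial.eval g.1 (rl2 l.1 l.2.1 l.2.2 h) := by
  unfold meetL at hm
  induction h using MvPolynomial.induction_on with
  | C a => simp [rl1, rl2, aeval_C, Polynomial.algebraMap_apply]
  | add f g hf hg => simp only [map_add, Polynomial.eval_add, hf, hg]
  | mul_X f j hf =>
    simp only [map_mul, Polynomial.eval_mul, hf]
    congr 1
    rcases j with _ | j
    · simp [rl1, rl2]
    · fin_cases j
      · simp [rl1, rl2]
      · simp [rl1, rl2, hm]

lemma rl1_deg (x m c : K) (h : MvPolynomial (Option (Fin 2)) K) : (rl1 x m c h).natDegree ≤ h.totalDegree := by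
  refine natDegree_aeval_le _ ?_ h
  intro i
  rcases i with _ | i
  · simp
  · fin_cases i
    · simp
    · simp; compute_degree
lemma rl2_deg (x m c : K) (h : MvPolynomial (Option (Fin 2)) K) : (rl2 x m c h).natDegree ≤ h.totalDegree := by
  refine natDegree_aeval_le _ ?_ h
  intro i
  rcases i with _ | i
  · simp
  · fin_cases i
    · simp
    · simp; compute_degree

open scoped Classical in
lemma count_prime [Infinite K] (p : ℕ) [Fact p.Prime] [CharP K p] (F : Finset (K × K × K)) (k D : ℕ)
    (hk1 : ∀ x0, (F.filter fun g => g.1 = x0).card ≤ k)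
    (hk2 : ∀ α β γ δ : K, (F.filter fun g => g.2.1 = α * g.1 + γ ∧ g.2.2 = β * g.1 + δ).card ≤ k)
    (h : MvPolynomial (Option (Fin 2)) K) (hp : Prime h) (hdeg : h.totalDegree < p)
    (T : Finset (K × K × K)) (hT : ∀ l ∈ T, ∀ l' ∈ T, l.1 = l'.1 → l.2.1 = l'.2.1)
    (hTD : ∀ l ∈ T, D ≤ (F.filter fun g => meetL l g).card)
    (hTh : ∀ l ∈ T, rl2 l.1 l.2.1 l.2.2 h = 0) :
    T.card * D ≤ F.card * h.totalDegree + 3 * h.totalDegree ^ 2 * D + k * T.card := by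
  by_cases hH : h ∣ flexP (some 0) (some 1) h
  swap
  · have h1 := bezout_lines h _ hp hH T hT hTh (fun l hl => rl2_flex _ _ _ _ (hTh l hl))
    have h2 : T.card ≤ 3 * h.totalDegree ^ 2 := by
      refine h1.trans ?_
      have := Nat.mul_le_mul_left h.totalDegree (flex_deg (some 0) (some 1) h)
      nlinarith
    have := Nat.mul_le_mul_right D h2
    omega
  set Fh := F.filter fun g => rl1 g.1 g.2.1 g.2.2 h = 0 with hFh
  have hFk : Fh.card ≤ k := by
    rcases flex_family p h hp hdeg hH with ⟨x0, hx⟩ | ⟨α, β, γ, δ, hx⟩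
    · refine le_trans (Finset.card_le_card ?_) (hk1 x0)
      intro g hg
      rw [hFh, Finset.mem_filter] at hg
      exact Finset.mem_filter.mpr ⟨hg.1, hx _ _ _ hg.2⟩
    · refine le_trans (Finset.card_le_card ?_) (hk2 α β γ δ)
      intro g hg
      rw [hFh, Finset.mem_filter] at hg
      exact Finset.mem_filter.mpr ⟨hg.1, hx _ _ _ hg.2⟩
  have c1 : T.card * D ≤ ∑ l ∈ T, (F.filter fun g => meetL l g).card := by
    rw [← smul_eq_mul]; exact Finset.card_nsmul_le_sum _ _ _ hTD
  have c2 : ∑ l ∈ T, (F.filter fun g => meetL l g).card = ∑ g ∈ F, (T.filter fun l => meetL l g).card :=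
    Finset.sum_card_bipartiteAbove_eq_sum_card_bipartiteBelow _
  have c3 : ∀ g ∈ F, (T.filter fun l => meetL l g).card ≤ h.totalDegree + if rl1 g.1 g.2.1 g.2.2 h = 0 then T.card else 0 := by
    intro g hg
    split_ifs with h0
    · exact (Finset.card_le_card (Finset.filter_subset _ _)).trans (Nat.le_add_left _ _)
    · rw [add_zero]
      refine le_trans ?_ (rl1_deg g.1 g.2.1 g.2.2 h)
      refine le_trans ?_ (Polynomial.card_roots' _)
      refine le_trans ?_ (Multiset.toFinset_card_le _)
      refine Finset.card_le_card_of_injOn (fun l => l.1) ?_ ?_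
      · intro l hl
        rw [Finset.mem_coe, Finset.mem_filter] at hl
        rw [Finset.mem_coe, Multiset.mem_toFinset, Polynomial.mem_roots h0, Polynomial.IsRoot, rl_meet l g hl.2,
          hTh l hl.1, Polynomial.eval_zero]
      · intro l hl l' hl' he
        rw [Finset.mem_coe, Finset.mem_filter] at hl hl'
        have e1 : l.1 = l'.1 := he
        have e2 := hT l hl.1 l' hl'.1 e1
        have m1 := hl.2
        have m2 := hl'.2
        unfold meetL at m1 m2
        rw [e1, e2] at m1
        refine Prod.ext e1 (Prod.ext e2 ?_)
        linear_combination m1 - m2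
  have c4 := Finset.sum_le_sum c3
  rw [Finset.sum_add_distrib, Finset.sum_const, smul_eq_mul, ← Finset.sum_filter, Finset.sum_const, smul_eq_mul] at c4
  have c5 : Fh.card * T.card ≤ k * T.card := Nat.mul_le_mul_right _ hFk
  rw [hFh] at c5
  omega

open scoped Classical in
theorem count_all [Infinite K] (p : ℕ) [Fact p.Prime] [CharP K p] (F : Finset (K × K × K)) (k D : ℕ)
    (hk1 : ∀ x0, (F.filter fun g => g.1 = x0).card ≤ k)
    (hk2 : ∀ α β γ δ : K, (F.filter fun g => g.2.1 = α * g.1 + γ ∧ g.2.2 = β * g.1 + δ).card ≤ k)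
    (f : MvPolynomial (Option (Fin 2)) K) (hf : f ≠ 0) (hdeg : f.totalDegree < p)
    (T : Finset (K × K × K)) (hT : ∀ l ∈ T, ∀ l' ∈ T, l.1 = l'.1 → l.2.1 = l'.2.1)
    (hTD : ∀ l ∈ T, D ≤ (F.filter fun g => meetL l g).card)
    (hTh : ∀ l ∈ T, rl2 l.1 l.2.1 l.2.2 f = 0) :
    T.card * D ≤ F.card * f.totalDegree + 3 * f.totalDegree ^ 2 * D + k * T.card := by
  induction f using UniqueFactorizationMonoid.induction_on_prime generalizing T with
  | h₁ => exact absurd rfl hf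
  | h₂ u hu =>
    have : T = ∅ := by
      rw [Finset.eq_empty_iff_forall_notMem]
      intro l hl
      have := hu.map (rl2 l.1 l.2.1 l.2.2)
      rw [hTh l hl] at this
      exact not_isUnit_zero this
    simp [this]
  | h₃ u h hu hh ih =>
    have hd : (h * u).totalDegree = h.totalDegree + u.totalDegree := totalDegree_mul_of_isDomain hh.ne_zero hu
    set T1 := T.filter fun l => rl2 l.1 l.2.1 l.2.2 h = 0 with hT1
    set T2 := T.filter fun l => ¬ rl2 l.1 l.2.1 l.2.2 h = 0 with hT2
    have hc : T1.card + T2.card = T.card := Finset.card_filter_add_card_filter_not _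
    have s1 : T1 ⊆ T := Finset.filter_subset _ _
    have s2 : T2 ⊆ T := Finset.filter_subset _ _
    have r1 := count_prime p F k D hk1 hk2 h hh (by omega) T1 (fun l hl l' hl' => hT l (s1 hl) l' (s1 hl'))
      (fun l hl => hTD l (s1 hl)) (fun l hl => (Finset.mem_filter.mp hl).2)
    have r2 := ih hu (by omega) T2 (fun l hl l' hl' => hT l (s2 hl) l' (s2 hl'))
      (fun l hl => hTD l (s2 hl)) (fun l hl => by
        have := hTh l (s2 hl)
        rw [map_mul, mul_eq_zero] at this
        exact this.resolve_left (Finset.mem_filter.mp hl).2)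
    rw [hd, ← hc]
    nlinarith [Nat.zero_le (h.totalDegree * u.totalDegree * D)]
end Cnt

open Finset

section Greedy

open scoped Classical in
lemma greedy {ι κ : Type*} (F : Finset ι) (T : Finset κ) (r : κ → ι → Prop) (D s : ℕ)
    (hD : 0 < D) (hs : 2 * s ≤ D) (hTD : ∀ l ∈ T, D ≤ (F.filter (r l)).card) :
    ∃ S ⊆ F, S.card * D ≤ 4 * F.card * s + D ∧
      T.card ≤ 2 * (T.filter fun l => s ≤ (S.filter (r l)).card).card := by
  set M := F.card with hM
  set t := T.card with ht
  by_cases ht0 : t = 0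
  · exact ⟨∅, Finset.empty_subset _, by simp, by omega⟩
  have step : ∀ j : ℕ, ∃ S ⊆ F, S.card ≤ j ∧
      (t ≤ 2 * (T.filter fun l => s ≤ (S.filter (r l)).card).card ∨
        t * D * j ≤ 4 * M * ∑ l ∈ T, min (S.filter (r l)).card s) := by
    intro j
    induction j with
    | zero => exact ⟨∅, Finset.empty_subset _, by simp, Or.inr (by simp)⟩
    | succ j ih =>
      obtain ⟨S, hSF, hSj, hS⟩ := ih
      by_cases hgood : t ≤ 2 * (T.filter fun l => s ≤ (S.filter (r l)).card).card
      · exact ⟨S, hSF, by omega, Or.inl hgood⟩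
      have hpot := hS.resolve_left hgood
      set U := T.filter fun l => ¬ s ≤ (S.filter (r l)).card with hU
      have hUc : (T.filter fun l => s ≤ (S.filter (r l)).card).card + U.card = t :=
        Finset.card_filter_add_card_filter_not _
      have hU2 : t ≤ 2 * U.card := by omega
      have h1 : ∀ l ∈ U, D ≤ 2 * ((F \ S).filter (r l)).card := by
        intro l hl
        rw [hU, Finset.mem_filter] at hl
        have := hTD l hl.1
        have h2 : (F.filter (r l)).card ≤ ((F \ S).filter (r l)).card + (S.filter (r l)).card := by
          refine le_trans (Finset.card_le_card ?_) (Finset.card_union_le _ _)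
          intro g hg
          rw [Finset.mem_filter] at hg
          by_cases hgS : g ∈ S
          · exact Finset.mem_union_right _ (Finset.mem_filter.mpr ⟨hgS, hg.2⟩)
          · exact Finset.mem_union_left _ (Finset.mem_filter.mpr ⟨Finset.mem_sdiff.mpr ⟨hg.1, hgS⟩, hg.2⟩)
        omega
      have h3 : U.card * D ≤ 2 * ∑ g ∈ F \ S, (U.filter fun l => r l g).card := by
        have e : ∑ l ∈ U, ((F \ S).filter (r l)).card = ∑ g ∈ F \ S, (U.filter fun l => r l g).card :=
          Finset.sum_card_bipartiteAbove_eq_sum_card_bipartiteBelow _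
        rw [← e, Finset.mul_sum, ← smul_eq_mul]
        exact Finset.card_nsmul_le_sum _ _ _ h1
      have h4 : ∃ g ∈ F \ S, t * D ≤ 4 * M * (U.filter fun l => r l g).card := by
        by_contra hcon
        push Not at hcon
        have hne : (F \ S).Nonempty := by
          rw [Finset.nonempty_iff_ne_empty]
          intro he
          rw [he, Finset.sum_empty] at h3
          have : 0 < U.card * D := Nat.mul_pos (by omega) hD
          omega
        have h5 := Finset.sum_lt_sum_of_nonempty hne hcon
        rw [← Finset.mul_sum, Finset.sum_const, smul_eq_mul] at h5
        have h6 : (F \ S).card ≤ M := Finset.card_le_card Finset.sdiff_subset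
        have h7 : (F \ S).card * (t * D) ≤ M * (t * D) := Nat.mul_le_mul_right _ h6
        have h8 : t * D ≤ 2 * U.card * D := Nat.mul_le_mul_right _ hU2
        have h9 : M * (t * D) ≤ M * (4 * ∑ g ∈ F \ S, (U.filter fun l => r l g).card) :=
          Nat.mul_le_mul_left _ (by nlinarith)
        nlinarith
      obtain ⟨g, hg, hg2⟩ := h4
      rw [Finset.mem_sdiff] at hg
      refine ⟨insert g S, Finset.insert_subset hg.1 hSF, ?_, Or.inr ?_⟩
      · exact (Finset.card_insert_le _ _).trans (by omega)
      have h10 : ∑ l ∈ T, min (S.filter (r l)).card s + (U.filter fun l => r l g).card ≤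
          ∑ l ∈ T, min ((insert g S).filter (r l)).card s := by
        have e : (U.filter fun l => r l g).card = ∑ l ∈ T, if (¬ s ≤ (S.filter (r l)).card) ∧ r l g then 1 else 0 := by
          rw [hU, Finset.filter_filter, Finset.card_filter]
        rw [e, ← Finset.sum_add_distrib]
        refine Finset.sum_le_sum fun l _ => ?_
        rw [Finset.filter_insert]
        by_cases hr : r l g
        · rw [if_pos hr, Finset.card_insert_of_notMem (by simp [hg.2])]
          split_ifs <;> omega
        · rw [if_neg hr]; simp [hr]
      have h11 := Nat.mul_le_mul_left (4 * M) h10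
      rw [mul_add] at h11
      rw [mul_add, mul_one]
      omega
  obtain ⟨S, hSF, hSj, hS⟩ := step (4 * M * s / D + 1)
  have hdm := Nat.div_add_mod (4 * M * s) D
  have hml := Nat.mod_lt (4 * M * s) hD
  refine ⟨S, hSF, ?_, ?_⟩
  · have := Nat.mul_le_mul_right D hSj
    rw [add_mul, one_mul] at this
    have h2 := Nat.div_mul_le_self (4 * M * s) D
    linarith
  · refine hS.resolve_right fun hc => ?_
    have h1 : ∑ l ∈ T, min (S.filter (r l)).card s ≤ t * s := by
      rw [← smul_eq_mul]; exact Finset.sum_le_card_nsmul _ _ _ fun l _ => min_le_right _ _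
    have h2 := Nat.mul_le_mul_left (4 * M) h1
    have h3 : 4 * M * s < D * (4 * M * s / D + 1) := by rw [mul_add]; omega
    have h4 := Nat.mul_lt_mul_of_pos_left h3 (Nat.pos_of_ne_zero ht0)
    nlinarith
end Greedy

section Interp
open MvPolynomial
variable {K : Type*} [Field K]

lemma interp (S : Finset (K × K × K)) (e : ℕ) (hS : 6 * S.card < (e+2)*(e+3)) :
    ∃ f : MvPolynomial (Option (Fin 2)) K, f ≠ 0 ∧ f.totalDegree ≤ e ∧ ∀ g ∈ S, rl1 g.1 g.2.1 g.2.2 f = 0 := by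
  let V := restrictTotalDegree (Option (Fin 2)) K e
  let φ : MvPolynomial (Option (Fin 2)) K →ₗ[K] (S × Fin (e+1) → K) :=
    LinearMap.pi fun i => (Polynomial.lcoeff K i.2).comp (rl1 i.1.1.1 i.1.1.2.1 i.1.1.2.2).toLinearMap
  have hφ : ∀ f i, φ f i = (rl1 i.1.1.1 i.1.1.2.1 i.1.1.2.2 f).coeff i.2 := fun f i => rfl
  have hlt : Module.finrank K (S × Fin (e+1) → K) < Module.finrank K V := by
    rw [Module.finrank_fintype_fun_eq_card, Fintype.card_prod, Fintype.card_coe, Fintype.card_fin]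
    have := finrank_rtd (K := K) e
    change 6 * Module.finrank K V = _ at this
    nlinarith
  have hk := LinearMap.ker_ne_bot_of_finrank_lt (f := φ.domRestrict V) hlt
  obtain ⟨⟨f, hfV⟩, hf, hf0⟩ := (Submodule.ne_bot_iff _).mp hk
  have hdeg : f.totalDegree ≤ e := (mem_restrictTotalDegree _ _ _).mp hfV
  refine ⟨f, fun h => hf0 (Subtype.ext h), hdeg, ?_⟩
  intro g hg
  have h0 : φ f = 0 := hf
  ext i
  by_cases hi : i < e + 1
  · have := congrFun h0 (⟨g, hg⟩, ⟨i, hi⟩)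
    rw [hφ] at this
    simpa using this
  · rw [Polynomial.coeff_eq_zero_of_natDegree_lt, Polynomial.coeff_zero]
    have := rl1_deg g.1 g.2.1 g.2.2 f
    omega

open scoped Classical in
theorem rich_bound [Infinite K] (p : ℕ) [Fact p.Prime] [CharP K p] (F : Finset (K × K × K)) (k D : ℕ)
    (hF : ∀ l ∈ F, ∀ l' ∈ F, l.1 = l'.1 → l.2.1 = l'.2.1)
    (hk1 : ∀ x0, (F.filter fun g => g.1 = x0).card ≤ k)
    (hk2 : ∀ α β γ δ : K, (F.filter fun g => g.2.1 = α * g.1 + γ ∧ g.2.2 = β * g.1 + δ).card ≤ k)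
    (hM : F.card ≤ 4 * p ^ 2) (hD0 : 0 < D) (hD : 3600 * F.card ≤ D ^ 2) (hDk : 2 * k ≤ D)
    (T : Finset (K × K × K)) (hT : ∀ l ∈ T, ∀ l' ∈ T, l.1 = l'.1 → l.2.1 = l'.2.1)
    (hTD : ∀ l ∈ T, D ≤ (F.filter fun g => meetL l g).card) :
    T.card * D ^ 2 ≤ 8216 * F.card ^ 2 := by
  rcases T.eq_empty_or_nonempty with rfl | ⟨l0, hl0⟩
  · simp
  have hDM : D ≤ F.card := (hTD l0 hl0).trans (Finset.card_le_card (Finset.filter_subset _ _))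
  set M := F.card with hMdef
  have hdm := Nat.div_add_mod (24 * M) D
  have hml := Nat.mod_lt (24 * M) hD0
  set e := 24 * M / D + 2 with he
  have e1 : 24 * M ≤ D * e := by rw [he, mul_add]; omega
  have e2 : D * e ≤ 26 * M := by rw [he, mul_add]; omega
  have hD60 : 60 ≤ D := by nlinarith
  have hes : 2 * (e + 1) ≤ D := by
    by_contra hc
    push Not at hc
    have : D * D < D * (2 * (e+1)) := Nat.mul_lt_mul_of_pos_left hc hD0
    nlinarith
  have hep : e < p := by
    by_contra hc
    push Not at hc
    have a1 : (D * e)^2 ≤ (26 * M)^2 := Nat.pow_le_pow_left e2 2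
    have a2 : p^2 ≤ e^2 := Nat.pow_le_pow_left hc 2
    have a3 : 3600 * M * e^2 ≤ D^2 * e^2 := Nat.mul_le_mul_right _ hD
    have a4 : 3600 * M * p^2 ≤ 3600 * M * e^2 := Nat.mul_le_mul_left _ a2
    have a5 : 3600 * M * p^2 ≤ 676 * M * M := by nlinarith
    have a6 : 676 * M * M ≤ 676 * M * (4 * p^2) := Nat.mul_le_mul_left _ hM
    have a7 : 0 < M * p^2 := Nat.mul_pos (by omega) (pow_pos (Fact.out : p.Prime).pos 2)
    nlinarith
  obtain ⟨S, hSF, hSc, hSt⟩ := greedy F T meetL D (e+1) hD0 hes hTD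
  have h6 : 6 * S.card < (e+2)*(e+3) := by
    have b1 : D * (6 * S.card) < D * ((e+2)*(e+3)) := by
      have : 24 * M * (e+1) ≤ D * e * (e+1) := Nat.mul_le_mul_right _ e1
      nlinarith
    exact Nat.lt_of_mul_lt_mul_left b1
  obtain ⟨f, hf0, hfe, hfS⟩ := interp S e h6
  set T' := T.filter fun l => e + 1 ≤ (S.filter (meetL l)).card with hT'
  have s1 : T' ⊆ T := Finset.filter_subset _ _
  have hfT : ∀ l ∈ T', rl2 l.1 l.2.1 l.2.2 f = 0 := by
    intro l hl
    by_contra hne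
    have hlc := (Finset.mem_filter.mp hl).2
    have : (S.filter (meetL l)).card ≤ e := by
      refine le_trans ?_ ((rl2_deg l.1 l.2.1 l.2.2 f).trans hfe)
      refine le_trans ?_ (Polynomial.card_roots' _)
      refine le_trans ?_ (Multiset.toFinset_card_le _)
      refine Finset.card_le_card_of_injOn (fun g => g.1) ?_ ?_
      · intro g hg
        rw [Finset.mem_coe, Finset.mem_filter] at hg
        rw [Finset.mem_coe, Multiset.mem_toFinset, Polynomial.mem_roots hne, Polynomial.IsRoot, ← rl_meet l g hg.2,
          hfS g hg.1, Polynomial.eval_zero]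
      · intro g hg g' hg' heq
        rw [Finset.mem_coe, Finset.mem_filter] at hg hg'
        have e1 : g.1 = g'.1 := heq
        have e2 := hF g (hSF hg.1) g' (hSF hg'.1) e1
        have m1 := hg.2
        have m2 := hg'.2
        unfold meetL at m1 m2
        rw [e1, e2] at m1
        refine Prod.ext e1 (Prod.ext e2 ?_)
        linear_combination m2 - m1
    omega
  have hc := count_all p F k D hk1 hk2 f hf0 (by omega) T' (fun l hl l' hl' => hT l (s1 hl) l' (s1 hl'))
    (fun l hl => hTD l (s1 hl)) hfT
  set d := f.totalDegree
  rw [← hMdef] at hc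
  have c1 : M * d ≤ M * e := Nat.mul_le_mul_left _ hfe
  have c2 : 3 * d ^ 2 * D ≤ 3 * e^2 * D := Nat.mul_le_mul_right _ (Nat.mul_le_mul_left _ (Nat.pow_le_pow_left hfe 2))
  have c3 : 2 * k * T'.card ≤ D * T'.card := Nat.mul_le_mul_right _ hDk
  have c4 : T'.card * D ≤ 2 * (M * e + 3 * e^2 * D) := by nlinarith
  have c5 : T.card * D ≤ 4 * (M * e + 3 * e^2 * D) := by
    have := Nat.mul_le_mul_right D hSt
    nlinarith
  have c6 : T.card * D * D ≤ 4 * (M * e + 3 * e^2 * D) * D := Nat.mul_le_mul_right D c5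
  have c7 : M * (D * e) ≤ M * (26 * M) := Nat.mul_le_mul_left _ e2
  have c8 : (D * e)^2 ≤ (26 * M)^2 := Nat.pow_le_pow_left e2 2
  nlinarith

open scoped Classical in
theorem energy_bound [Infinite K] (p : ℕ) [Fact p.Prime] [CharP K p] (F T : Finset (K × K × K)) (k D0 : ℕ)
    (hF : ∀ l ∈ F, ∀ l' ∈ F, l.1 = l'.1 → l.2.1 = l'.2.1)
    (hk1 : ∀ x0, (F.filter fun g => g.1 = x0).card ≤ k)
    (hk2 : ∀ α β γ δ : K, (F.filter fun g => g.2.1 = α * g.1 + γ ∧ g.2.2 = β * g.1 + δ).card ≤ k)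
    (hM : F.card ≤ 4 * p ^ 2) (hD0 : 0 < D0) (hD : 3600 * F.card ≤ D0 ^ 2) (hDk : 2 * k ≤ D0)
    (hT : ∀ l ∈ T, ∀ l' ∈ T, l.1 = l'.1 → l.2.1 = l'.2.1) (hTF : T.card = F.card) :
    ∑ l ∈ T, (F.filter fun g => meetL l g).card ≤ 4 * F.card * D0 := by
  set M := F.card with hMdef
  set d : K × K × K → ℕ := fun l => (F.filter fun g => meetL l g).card with hd
  have hdM : ∀ l, d l ≤ M := fun l => Finset.card_le_card (Finset.filter_subset _ _)
  have h1 : ∀ l, d l ≤ D0 + ((Finset.Ioc D0 (D0 + M)).filter fun D => D ≤ d l).card := by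
    intro l
    have : (Finset.Ioc D0 (D0 + M)).filter (fun D => D ≤ d l) = Finset.Ioc D0 (d l) := by
      ext D
      have := hdM l
      simp only [Finset.mem_filter, Finset.mem_Ioc]
      omega
    rw [this, Nat.card_Ioc]; omega
  have h2 : ∑ l ∈ T, d l ≤ M * D0 + ∑ D ∈ Finset.Ioc D0 (D0 + M), (T.filter fun l => D ≤ d l).card := by
    refine (Finset.sum_le_sum fun l _ => h1 l).trans ?_
    rw [Finset.sum_add_distrib, Finset.sum_const, smul_eq_mul, hTF]
    have := Finset.sum_card_bipartiteAbove_eq_sum_card_bipartiteBelow (s := T) (t := Finset.Ioc D0 (D0 + M))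
      (fun (l : K × K × K) (D : ℕ) => D ≤ d l)
    unfold Finset.bipartiteAbove Finset.bipartiteBelow at this
    rw [this]
  have h3 : ∀ D ∈ Finset.Ioc D0 (D0 + M), ((T.filter fun l => D ≤ d l).card : ℝ) ≤ 8216 * (M:ℝ)^2 * ((D:ℝ)^2)⁻¹ := by
    intro D hDm
    rw [Finset.mem_Ioc] at hDm
    have := rich_bound p F k D hF hk1 hk2 hM (by omega) (hD.trans (Nat.pow_le_pow_left (by omega) 2)) (by omega)
      (T.filter fun l => D ≤ d l)
      (fun l hl l' hl' => hT l (Finset.mem_filter.mp hl).1 l' (Finset.mem_filter.mp hl').1)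
      (fun l hl => (Finset.mem_filter.mp hl).2)
    have hDp : (0:ℝ) < (D:ℝ)^2 := by have : 0 < D := by omega
                                     positivity
    rw [← div_eq_mul_inv, le_div_iff₀ hDp]
    exact_mod_cast this
  have h4 := Finset.sum_le_sum h3
  rw [← Finset.mul_sum] at h4
  have h5 : ∑ i ∈ Finset.Ioc D0 (D0 + M), ((i:ℝ)^2)⁻¹ ≤ (D0:ℝ)⁻¹ - ((D0 + M : ℕ):ℝ)⁻¹ :=
    sum_Ioc_inv_sq_le_sub (by omega) (by omega)
  have h6 : (0:ℝ) ≤ ((D0 + M : ℕ):ℝ)⁻¹ := by positivity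
  have hD0' : (0:ℝ) < D0 := by exact_mod_cast hD0
  have h7 : 8216 * (M:ℝ)^2 * ∑ i ∈ Finset.Ioc D0 (D0 + M), ((i:ℝ)^2)⁻¹ ≤ 3 * M * D0 := by
    calc _ ≤ 8216 * (M:ℝ)^2 * (D0:ℝ)⁻¹ := by gcongr; linarith
      _ ≤ 3 * M * D0 := by
        rw [← div_eq_mul_inv, div_le_iff₀ hD0']
        have : (3600:ℝ) * M ≤ D0^2 := by exact_mod_cast hD
        nlinarith [mul_le_mul_of_nonneg_left this (Nat.cast_nonneg (α := ℝ) M)]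
  have h8 : ((∑ l ∈ T, d l : ℕ) : ℝ) ≤ ((4 * M * D0 : ℕ) : ℝ) := by
    have : ((∑ l ∈ T, d l : ℕ) : ℝ) ≤ ((M * D0 + ∑ D ∈ Finset.Ioc D0 (D0 + M), (T.filter fun l => D ≤ d l).card : ℕ) : ℝ) := by
      exact_mod_cast h2
    push_cast at this ⊢
    linarith
  exact_mod_cast h8
end Interp

open Finset



section Fin7
variable {p : ℕ} [Fact p.Prime]

lemma sec_mom_pair (u v : ZMod p × ZMod p) :
    ((Finset.univ : Finset (ZMod p × ZMod p)).filter
      (fun mc => u.2 = mc.1 * u.1 + mc.2 ∧ v.2 = mc.1 * v.1 + mc.2)).card ≤ 1 + if u = v then p else 0 := by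
  by_cases huv : u = v
  · subst huv
    simp only [and_self, if_true]
    have : ((Finset.univ : Finset (ZMod p × ZMod p)).filter (fun mc => u.2 = mc.1 * u.1 + mc.2)).card
        ≤ (Finset.univ : Finset (ZMod p)).card := by
      refine Finset.card_le_card_of_injOn (fun mc => mc.1) (fun _ _ => Finset.mem_coe.mpr (Finset.mem_univ _)) ?_
      intro x hx y hy hxy
      rw [Finset.mem_coe, Finset.mem_filter] at hx hy
      have h1 : x.1 = y.1 := hxy
      have h2 := hx.2
      have h3 := hy.2
      rw [h1] at h2
      exact Prod.ext h1 (by linear_combination h3 - h2)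
    rw [Finset.card_univ, ZMod.card] at this
    omega
  · rw [if_neg huv, add_zero, Finset.card_le_one]
    intro x hx y hy
    rw [Finset.mem_filter] at hx hy
    obtain ⟨-, x1, x2⟩ := hx
    obtain ⟨-, y1, y2⟩ := hy
    have h0 : (x.1 - y.1) * (u.1 - v.1) = 0 := by linear_combination -x1 + x2 + y1 - y2
    have h1 : x.1 = y.1 := by
      rcases mul_eq_zero.mp h0 with h | h
      · exact sub_eq_zero.mp h
      · exfalso
        apply huv
        have h' := sub_eq_zero.mp h
        refine Prod.ext h' ?_
        rw [x1, x2, h']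
    refine Prod.ext h1 ?_
    rw [h1] at x1
    linear_combination y1 - x1

lemma inc_eq_sum (A B : Finset (ZMod p)) (m c : ZMod p) :
    inc A B m c = ∑ u ∈ A ×ˢ B, if u.2 = m * u.1 + c then 1 else 0 := by
  rw [inc, Finset.card_filter]

lemma sum_inc (A B : Finset (ZMod p)) :
    ∑ mc : ZMod p × ZMod p, inc A B mc.1 mc.2 = p * A.card * B.card := by
  simp only [inc_eq_sum]
  rw [Finset.sum_comm]
  have : ∀ u ∈ A ×ˢ B, ∑ mc : ZMod p × ZMod p, (if u.2 = mc.1 * u.1 + mc.2 then 1 else 0) = p := by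
    intro u _
    rw [Fintype.sum_prod_type]
    have : ∀ m : ZMod p, ∑ c : ZMod p, (if u.2 = m * u.1 + c then 1 else 0) = 1 := by
      intro m
      rw [Finset.sum_eq_single (u.2 - m * u.1)]
      · simp
      · intro c _ hc
        rw [if_neg]
        intro h
        exact hc (by linear_combination -h)
      · simp
    simp [this, ZMod.card]
  rw [Finset.sum_congr rfl this, Finset.sum_const, Finset.card_product, smul_eq_mul]
  ring

lemma sum_inc_sq (A B : Finset (ZMod p)) :
    ∑ mc : ZMod p × ZMod p, (inc A B mc.1 mc.2)^2 ≤ (A.card * B.card)^2 + p * (A.card * B.card) := by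
  have e : ∀ mc : ZMod p × ZMod p, (inc A B mc.1 mc.2)^2 = ∑ u ∈ A ×ˢ B, ∑ v ∈ A ×ˢ B,
      if (u.2 = mc.1 * u.1 + mc.2 ∧ v.2 = mc.1 * v.1 + mc.2) then 1 else 0 := by
    intro mc
    rw [sq, inc_eq_sum, Finset.sum_mul_sum]
    refine Finset.sum_congr rfl fun u _ => Finset.sum_congr rfl fun v _ => ?_
    by_cases h1 : u.2 = mc.1 * u.1 + mc.2 <;> by_cases h2 : v.2 = mc.1 * v.1 + mc.2 <;> simp [h1, h2]
  rw [Finset.sum_congr rfl fun mc _ => e mc, Finset.sum_comm]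
  have : ∀ u ∈ A ×ˢ B, ∑ mc : ZMod p × ZMod p, ∑ v ∈ A ×ˢ B,
      (if (u.2 = mc.1 * u.1 + mc.2 ∧ v.2 = mc.1 * v.1 + mc.2) then 1 else 0) ≤ A.card * B.card + p := by
    intro u hu
    rw [Finset.sum_comm]
    have h1 : ∀ v ∈ A ×ˢ B, ∑ mc : ZMod p × ZMod p,
      (if (u.2 = mc.1 * u.1 + mc.2 ∧ v.2 = mc.1 * v.1 + mc.2) then 1 else 0) ≤ 1 + if u = v then p else 0 := by
      intro v _
      rw [← Finset.card_filter]
      exact sec_mom_pair u v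
    refine (Finset.sum_le_sum h1).trans ?_
    rw [Finset.sum_add_distrib, Finset.sum_ite_eq, if_pos hu, Finset.sum_const, Finset.card_product]
    simp
  refine (Finset.sum_le_card_nsmul _ _ _ this).trans ?_
  rw [Finset.card_product, smul_eq_mul]
  apply le_of_eq; ring

lemma second_moment (A B : Finset (ZMod p)) (L : Finset (ZMod p × ZMod p)) (N : ℕ)
    (hN : 2 * A.card * B.card ≤ p * N) (hL : ∀ l ∈ L, N < inc A B l.1 l.2) :
    L.card * N^2 ≤ 4 * p * A.card * B.card := by
  have hp : (0:ℝ) < p := by exact_mod_cast (Fact.out : p.Prime).pos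
  set w : ℝ := (A.card * B.card : ℝ) / p with hw
  have hwN : 2 * w ≤ N := by
    rw [hw, ← mul_div_assoc, div_le_iff₀ hp]
    have : ((2 * A.card * B.card : ℕ):ℝ) ≤ ((p * N : ℕ):ℝ) := by exact_mod_cast hN
    push_cast at this
    linarith
  have hwp : w * p = A.card * B.card := by rw [hw]; field_simp
  have s1 : (∑ mc : ZMod p × ZMod p, (inc A B mc.1 mc.2 : ℝ)) = p * A.card * B.card := by
    exact_mod_cast sum_inc A B
  have s2 : (∑ mc : ZMod p × ZMod p, (inc A B mc.1 mc.2 : ℝ)^2) ≤ (A.card * B.card)^2 + p * (A.card * B.card) := by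
    exact_mod_cast sum_inc_sq A B
  have s3 : ∑ mc : ZMod p × ZMod p, ((inc A B mc.1 mc.2 : ℝ) - w)^2 ≤ p * (A.card * B.card) := by
    have : ∑ mc : ZMod p × ZMod p, ((inc A B mc.1 mc.2 : ℝ) - w)^2 =
      (∑ mc : ZMod p × ZMod p, (inc A B mc.1 mc.2 : ℝ)^2) - 2 * w * (∑ mc : ZMod p × ZMod p, (inc A B mc.1 mc.2 : ℝ))
        + (p * w)^2 := by
      rw [Finset.mul_sum, ← Finset.sum_sub_distrib]
      have h : (p * w)^2 = ∑ mc : ZMod p × ZMod p, w^2 := by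
        rw [Finset.sum_const, Finset.card_univ, Fintype.card_prod, ZMod.card]
        simp only [nsmul_eq_mul, Nat.cast_mul]; ring
      rw [h, ← Finset.sum_add_distrib]
      refine Finset.sum_congr rfl fun mc _ => ?_
      ring
    rw [this, s1]
    have h2 : 2 * w * (p * A.card * B.card) = 2 * (A.card * B.card : ℝ)^2 := by
      linear_combination 2 * (A.card * B.card : ℝ) * hwp
    have h3 : (p * w)^2 = (A.card * B.card : ℝ)^2 := by rw [← hwp]; ring
    rw [h2, h3]; linarith
  have s4 : ∑ l ∈ L, ((N:ℝ)/2)^2 ≤ ∑ mc : ZMod p × ZMod p, ((inc A B mc.1 mc.2 : ℝ) - w)^2 := by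
    have h0 : ∑ l ∈ L, ((N:ℝ)/2)^2 ≤ ∑ mc ∈ L, ((inc A B mc.1 mc.2 : ℝ) - w)^2 := by
      refine Finset.sum_le_sum fun l hl => ?_
      have h1 : (N:ℝ) < (inc A B l.1 l.2 : ℝ) := by exact_mod_cast hL l hl
      have h2 : (N:ℝ)/2 ≤ (inc A B l.1 l.2 : ℝ) - w := by linarith
      have h3 : (0:ℝ) ≤ (N:ℝ)/2 := by positivity
      exact pow_le_pow_left₀ h3 h2 2
    refine h0.trans (Finset.sum_le_sum_of_subset_of_nonneg (Finset.subset_univ L) ?_)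
    intro l _ _
    exact sq_nonneg _
  rw [Finset.sum_const, nsmul_eq_mul] at s4
  have : ((L.card * N^2 : ℕ):ℝ) ≤ ((4 * p * A.card * B.card : ℕ) : ℝ) := by
    push_cast
    linarith
  exact_mod_cast this

lemma pencil (A B : Finset (ZMod p)) (L : Finset (ZMod p × ZMod p)) (N : ℕ)
    (hL : ∀ l ∈ L, N < inc A B l.1 l.2) (P0 : ZMod p × ZMod p)
    (hP : ∀ l ∈ L, ∀ l' ∈ L, l ≠ l' → ∀ u : ZMod p × ZMod p, u.2 = l.1 * u.1 + l.2 → u.2 = l'.1 * u.1 + l'.2 → u = P0) :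
    L.card * N ≤ A.card * B.card := by
  let Q : ZMod p × ZMod p → Finset (ZMod p × ZMod p) := fun l =>
    ((A ×ˢ B).filter (fun xy => xy.2 = l.1 * xy.1 + l.2)).erase P0
  have hQ : ∀ l ∈ L, N ≤ (Q l).card := by
    intro l hl
    have h1 := hL l hl
    have h2 : _ ≤ (Q l).card := Finset.pred_card_le_card_erase
    unfold inc at h1
    omega
  have hd : (L : Set (ZMod p × ZMod p)).PairwiseDisjoint Q := by
    intro l hl l' hl' hne
    rw [Function.onFun, Finset.disjoint_left]
    intro u hu hu'
    simp only [Q, Finset.mem_erase, Finset.mem_filter] at hu hu'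
    exact hu.1 (hP l hl l' hl' hne u hu.2.2 hu'.2.2)
  calc L.card * N ≤ ∑ l ∈ L, (Q l).card := by
        rw [← smul_eq_mul]; exact Finset.card_nsmul_le_sum _ _ _ hQ
    _ = (L.biUnion Q).card := (Finset.card_biUnion hd).symm
    _ ≤ (A ×ˢ B).card := by
        apply Finset.card_le_card
        rw [Finset.biUnion_subset]
        intro l _
        exact (Finset.erase_subset _ _).trans (Finset.filter_subset _ _)
    _ = _ := Finset.card_product _ _

lemma lower (A B : Finset (ZMod p)) (L : Finset (ZMod p × ZMod p)) (N : ℕ)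
    (hL : ∀ l ∈ L, N < inc A B l.1 l.2) :
    (L.card * N)^2 ≤ B.card * ∑ u ∈ A ×ˢ L, ((A ×ˢ L).filter
      fun v => u.2.1 * v.1 + u.2.2 = v.2.1 * u.1 + v.2.2).card := by
  let r : ZMod p → ℕ := fun z => ∑ a ∈ A, ∑ l ∈ L, if l.1 * a + l.2 = z then 1 else 0
  have h1 : L.card * N ≤ ∑ z ∈ B, r z := by
    have e : ∑ z ∈ B, r z = ∑ l ∈ L, inc A B l.1 l.2 := by
      simp only [r, inc_eq_sum, Finset.sum_product]
      rw [Finset.sum_comm]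
      conv_rhs => rw [Finset.sum_comm]
      refine Finset.sum_congr rfl fun a _ => ?_
      rw [Finset.sum_comm]
      refine Finset.sum_congr rfl fun l _ => Finset.sum_congr rfl fun z _ => ?_
      simp only [eq_comm]
    rw [e, ← smul_eq_mul]
    exact Finset.card_nsmul_le_sum _ _ _ fun l hl => (hL l hl).le
  have h2 : ∑ z ∈ B, (r z)^2 ≤ ∑ u ∈ A ×ˢ L, ((A ×ˢ L).filter
      fun v => u.2.1 * v.1 + u.2.2 = v.2.1 * u.1 + v.2.2).card := by
    have e : ∑ u ∈ A ×ˢ L, ((A ×ˢ L).filter fun v => u.2.1 * v.1 + u.2.2 = v.2.1 * u.1 + v.2.2).card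
        = ∑ a ∈ A, ∑ l ∈ L, ∑ a' ∈ A, ∑ l' ∈ L, if l.1 * a + l.2 = l'.1 * a' + l'.2 then 1 else 0 := by
      simp only [Finset.card_filter, Finset.sum_product]
      calc ∑ a ∈ A, ∑ l ∈ L, ∑ a' ∈ A, ∑ l' ∈ L, (if l.1 * a' + l.2 = l'.1 * a + l'.2 then 1 else 0)
          = ∑ a ∈ A, ∑ a' ∈ A, ∑ l ∈ L, ∑ l' ∈ L, (if l.1 * a' + l.2 = l'.1 * a + l'.2 then 1 else 0) :=
            Finset.sum_congr rfl fun a _ => Finset.sum_comm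
        _ = ∑ a' ∈ A, ∑ a ∈ A, ∑ l ∈ L, ∑ l' ∈ L, (if l.1 * a' + l.2 = l'.1 * a + l'.2 then 1 else 0) :=
            Finset.sum_comm
        _ = _ := Finset.sum_congr rfl fun a _ => Finset.sum_comm
    rw [e]
    have e2 : ∀ z, (r z)^2 = ∑ a ∈ A, ∑ l ∈ L, ∑ a' ∈ A, ∑ l' ∈ L,
        if (l.1 * a + l.2 = z ∧ l'.1 * a' + l'.2 = z) then 1 else 0 := by
      intro z
      rw [sq]
      simp only [r, Finset.sum_mul, Finset.mul_sum]
      refine Finset.sum_congr rfl fun a _ => Finset.sum_congr rfl fun l _ =>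
        Finset.sum_congr rfl fun a' _ => Finset.sum_congr rfl fun l' _ => ?_
      by_cases h1 : l.1 * a + l.2 = z <;> by_cases h2 : l'.1 * a' + l'.2 = z <;> simp [h1, h2]
    simp only [e2]
    rw [Finset.sum_comm]
    refine Finset.sum_le_sum fun a _ => ?_
    rw [Finset.sum_comm]
    refine Finset.sum_le_sum fun l _ => ?_
    rw [Finset.sum_comm]
    refine Finset.sum_le_sum fun a' _ => ?_
    rw [Finset.sum_comm]
    refine Finset.sum_le_sum fun l' _ => ?_
    split_ifs with h
    · rw [← Finset.card_filter, Finset.card_le_one]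
      intro x hx y hy
      rw [Finset.mem_filter] at hx hy
      exact hx.2.1.symm.trans hy.2.1
    · refine le_of_eq (Finset.sum_eq_zero fun z _ => if_neg ?_)
      rintro ⟨h3, h4⟩
      exact h (h3.trans h4.symm)
  calc (L.card * N)^2 ≤ (∑ z ∈ B, r z)^2 := Nat.pow_le_pow_left h1 2
    _ ≤ B.card * ∑ z ∈ B, (r z)^2 := sq_sum_le_card_mul_sum_sq
    _ ≤ _ := Nat.mul_le_mul_left _ h2
end Fin7

open Finset

section Fin8
variable {p : ℕ} [Fact p.Prime]

lemma tau_indep {K : Type*} [Field K] (φ : ZMod p →+* K) (τ : K) (hτ : ∀ x, φ x ≠ τ) (a a' m m' : ZMod p)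
    (h : φ a - τ * φ m = φ a' - τ * φ m') : m = m' ∧ a = a' := by
  have hm : m = m' := by
    by_contra hne
    have h1 : φ (m - m') ≠ 0 := by
      rw [Ne, map_eq_zero]; exact sub_ne_zero.mpr hne
    apply hτ ((a - a') / (m - m'))
    rw [map_div₀, div_eq_iff h1, map_sub, map_sub]
    linear_combination h
  refine ⟨hm, φ.injective ?_⟩
  rw [hm] at h
  linear_combination h

open scoped Classical in
theorem main_bound (A B : Finset (ZMod p)) (L : Finset (ZMod p × ZMod p)) (N : ℕ) (hAB : A.card ≤ B.card)
    (hN1 : 1 < N) (hNA : N ≤ A.card)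
    (hL : ∀ l ∈ L, N < inc A B l.1 l.2) (hM4 : A.card * L.card ≤ 4 * p^2) :
    L.card * N^4 ≤ 921600 * (A.card^3 * B.card^2) := by
  by_cases hL0 : L.card = 0
  · rw [hL0]; omega
  let K := AlgebraicClosure (ZMod p)
  let φ : ZMod p →+* K := algebraMap (ZMod p) K
  have hinf : Infinite K := IsAlgClosed.instInfinite
  have hch : CharP K p := charP_of_injective_algebraMap φ.injective p
  obtain ⟨τ, hτ⟩ : ∃ τ : K, ∀ x, φ x ≠ τ := by
    obtain ⟨τ, hτ⟩ := Infinite.exists_notMem_finset ((Finset.univ : Finset (ZMod p)).image φ)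
    refine ⟨τ, fun x hx => hτ ?_⟩
    rw [← hx]
    exact Finset.mem_image_of_mem _ (Finset.mem_univ _)
  let Φ : ZMod p × ZMod p × ZMod p → K × K × K := fun u => (φ u.1 - τ * φ u.2.1, φ u.2.1, φ u.2.2)
  have hΦ : Function.Injective Φ := by
    intro u v h
    have h1 : φ u.1 - τ * φ u.2.1 = φ v.1 - τ * φ v.2.1 := congrArg (fun w => w.1) h
    have h2 : φ u.2.2 = φ v.2.2 := congrArg (fun w => w.2.2) h
    obtain ⟨hm, ha⟩ := tau_indep φ τ hτ _ _ _ _ h1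
    exact Prod.ext ha (Prod.ext hm (φ.injective h2))
  set F := (A ×ˢ L).image Φ with hFdef
  have hFc : F.card = A.card * L.card := by
    rw [hFdef, Finset.card_image_of_injective _ hΦ, Finset.card_product]
  have hF : ∀ l ∈ F, ∀ l' ∈ F, l.1 = l'.1 → l.2.1 = l'.2.1 := by
    intro l hl l' hl' h
    obtain ⟨u, hu, rfl⟩ := Finset.mem_image.mp hl
    obtain ⟨v, hv, rfl⟩ := Finset.mem_image.mp hl'
    exact congrArg φ (tau_indep φ τ hτ _ _ _ _ h).1
  set k := A.card * B.card / N with hk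
  have hkN : k * N ≤ A.card * B.card := Nat.div_mul_le_self _ _
  have hle : ∀ x : ℕ, x * N ≤ A.card * B.card → x ≤ k := fun x hx => (Nat.le_div_iff_mul_le (by omega)).mpr hx
  have hone : 1 ≤ k := hle 1 (by nlinarith)
  have hfil : ∀ (P : K × K × K → Prop) [DecidablePred P], (F.filter P).card = ((A ×ˢ L).filter fun u => P (Φ u)).card := by
    intro P _
    rw [hFdef, Finset.filter_image, Finset.card_image_of_injective _ hΦ]
  have hpen : ∀ (Q : ZMod p × ZMod p × ZMod p → Prop) [DecidablePred Q] (P0 : ZMod p × ZMod p),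
      (∀ u v, u ∈ A ×ˢ L → v ∈ A ×ˢ L → Q u → Q v → u.1 = v.1) →
      (∀ u v, u ∈ A ×ˢ L → v ∈ A ×ˢ L → Q u → Q v → u.2 ≠ v.2 → ∀ w : ZMod p × ZMod p,
        w.2 = u.2.1 * w.1 + u.2.2 → w.2 = v.2.1 * w.1 + v.2.2 → w = P0) →
      ((A ×ˢ L).filter Q).card ≤ k := by
    intro Q _ P0 h1 h2
    apply hle
    have e : ((A ×ˢ L).filter Q).card = (((A ×ˢ L).filter Q).image (fun u => u.2)).card := by
      rw [Finset.card_image_of_injOn]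
      intro u hu v hv huv
      rw [Finset.mem_coe, Finset.mem_filter] at hu hv
      exact Prod.ext (h1 u v hu.1 hv.1 hu.2 hv.2) huv
    rw [e]
    refine pencil A B _ N ?_ P0 ?_
    · intro l hl
      obtain ⟨u, hu, rfl⟩ := Finset.mem_image.mp hl
      exact hL _ (Finset.mem_product.mp (Finset.mem_filter.mp hu).1).2
    · intro l hl l' hl' hne w hw hw'
      obtain ⟨u, hu, rfl⟩ := Finset.mem_image.mp hl
      obtain ⟨v, hv, rfl⟩ := Finset.mem_image.mp hl'
      rw [Finset.mem_filter] at hu hv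
      exact h2 u v hu.1 hv.1 hu.2 hv.2 hne w hw hw'
  have hk1 : ∀ x0, (F.filter fun g => g.1 = x0).card ≤ k := by
    intro x0
    rw [hfil]
    refine hpen _ 0 ?_ ?_
    · intro u v _ _ hu hv
      exact (tau_indep φ τ hτ _ _ _ _ (hu.trans hv.symm)).2
    · intro u v _ _ hu hv hne w hw hw'
      have hm := (tau_indep φ τ hτ _ _ _ _ (hu.trans hv.symm)).1
      exfalso
      apply hne
      refine Prod.ext hm ?_
      rw [hm] at hw
      linear_combination hw' - hw
  have hk2 : ∀ α β γ δ : K, (F.filter fun g => g.2.1 = α * g.1 + γ ∧ g.2.2 = β * g.1 + δ).card ≤ k := by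
    intro α β γ δ
    rw [hfil]
    by_cases hα : 1 + α * τ = 0
    · have hα0 : α ≠ 0 := by rintro rfl; simp at hα
      have hQa : ∀ u v : ZMod p × ZMod p × ZMod p,
          ((Φ u).2.1 = α * (Φ u).1 + γ ∧ (Φ u).2.2 = β * (Φ u).1 + δ) →
          ((Φ v).2.1 = α * (Φ v).1 + γ ∧ (Φ v).2.2 = β * (Φ v).1 + δ) → u.1 = v.1 := by
        rintro u v ⟨hu, -⟩ ⟨hv, -⟩
        simp only [Φ] at hu hv
        apply φ.injective
        apply mul_left_cancel₀ hα0
        linear_combination hv - hu + (φ u.2.1 - φ v.2.1) * hα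
      have hQc : ∀ u v : ZMod p × ZMod p × ZMod p,
          ((Φ u).2.1 = α * (Φ u).1 + γ ∧ (Φ u).2.2 = β * (Φ u).1 + δ) →
          ((Φ v).2.1 = α * (Φ v).1 + γ ∧ (Φ v).2.2 = β * (Φ v).1 + δ) →
            φ u.2.2 - φ v.2.2 = - (β * τ) * (φ u.2.1 - φ v.2.1) := by
        intro u v hu hv
        have ha := hQa u v hu hv
        have h1 := hu.2
        have h2 := hv.2
        simp only [Φ] at h1 h2
        rw [ha] at h1
        linear_combination h1 - h2
      by_cases hs : ∃ s : ZMod p, φ s = - (β * τ)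
      · obtain ⟨s, hs⟩ := hs
        rcases ((A ×ˢ L).filter fun u => (Φ u).2.1 = α * (Φ u).1 + γ ∧ (Φ u).2.2 = β * (Φ u).1 + δ).eq_empty_or_nonempty with he | ⟨u0, hu0⟩
        · rw [he]; simp
        have hu0' := (Finset.mem_filter.mp hu0).2
        refine hpen _ (-s, u0.2.2 - s * u0.2.1) (fun u v _ _ hu hv => hQa u v hu hv) ?_
        intro u v _ _ hu hv hne w hw hw'
        have c1 : u.2.2 - v.2.2 = s * (u.2.1 - v.2.1) := by
          apply φ.injective
          rw [map_mul, map_sub, map_sub, hs]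
          exact hQc u v hu hv
        have c2 : u.2.2 - u0.2.2 = s * (u.2.1 - u0.2.1) := by
          apply φ.injective
          rw [map_mul, map_sub, map_sub, hs]
          exact hQc u u0 hu hu0'
        have hm : u.2.1 - v.2.1 ≠ 0 := by
          intro h0
          apply hne
          refine Prod.ext (sub_eq_zero.mp h0) (sub_eq_zero.mp ?_)
          rw [c1, h0, mul_zero]
        have hw1 : w.1 = -s := by
          apply mul_left_cancel₀ hm
          linear_combination hw' - hw - c1
        refine Prod.ext hw1 ?_
        change w.2 = u0.2.2 - s * u0.2.1
        rw [hw, hw1]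
        linear_combination c2
      · push Not at hs
        refine le_trans ?_ hone
        rw [Finset.card_le_one]
        intro u hu v hv
        rw [Finset.mem_filter] at hu hv
        have ha := hQa u v hu.2 hv.2
        have hc := hQc u v hu.2 hv.2
        have hm : u.2.1 = v.2.1 := by
          by_contra hne
          have h1 : φ (u.2.1 - v.2.1) ≠ 0 := by
            rw [Ne, map_eq_zero]; exact sub_ne_zero.mpr hne
          apply hs ((u.2.2 - v.2.2) / (u.2.1 - v.2.1))
          rw [map_div₀, div_eq_iff h1, map_sub, map_sub]
          exact hc
        refine Prod.ext ha (Prod.ext hm (φ.injective (sub_eq_zero.mp ?_)))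
        rw [hc, hm, sub_self, mul_zero]
    · have hAk : A.card ≤ k := hle _ (Nat.mul_le_mul_left _ (hNA.trans hAB))
      refine le_trans ?_ hAk
      refine Finset.card_le_card_of_injOn (fun u => u.1) ?_ ?_
      · intro u hu
        rw [Finset.mem_coe, Finset.mem_filter] at hu
        exact (Finset.mem_product.mp hu.1).1
      · intro u hu v hv huv
        rw [Finset.mem_coe, Finset.mem_filter] at hu hv
        have ha : u.1 = v.1 := huv
        obtain ⟨-, hu1, hu2⟩ := hu
        obtain ⟨-, hv1, hv2⟩ := hv
        simp only [Φ] at hu1 hu2 hv1 hv2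
        rw [ha] at hu1 hu2
        have hm : φ u.2.1 = φ v.2.1 := by
          apply mul_left_cancel₀ hα
          linear_combination hu1 - hv1
        have hc : φ u.2.2 = φ v.2.2 := by
          rw [hu2, hv2, hm]
        exact Prod.ext ha (Prod.ext (φ.injective hm) (φ.injective hc))
  set s := Nat.sqrt F.card with hs
  have hs1 : s * s ≤ F.card := Nat.sqrt_le _
  have hs2 : F.card < (s+1) * (s+1) := Nat.lt_succ_sqrt F.card
  have hF1 : 1 ≤ F.card := by
    rw [hFc]; exact Nat.mul_pos (by omega) (by omega)
  have hs0 : 1 ≤ s := by nlinarith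
  have hE := energy_bound p F F k (60 * (s+1) + 2 * k) hF hk1 hk2 (by rw [hFc]; exact hM4) (by omega)
    (by nlinarith [Nat.zero_le (s * k), Nat.zero_le (k*k)]) (by omega) hF rfl
  have hEe : ∑ l ∈ F, (F.filter fun g => meetL l g).card = ∑ u ∈ A ×ˢ L, ((A ×ˢ L).filter
      fun v => u.2.1 * v.1 + u.2.2 = v.2.1 * u.1 + v.2.2).card := by
    conv_lhs => rw [hFdef]
    rw [Finset.sum_image (fun u _ v _ h => hΦ h)]
    refine Finset.sum_congr rfl fun u _ => ?_
    rw [← hFdef, hfil]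
    congr 1
    refine Finset.filter_congr fun v _ => ?_
    simp only [meetL, Φ]
    constructor
    · intro h
      apply φ.injective
      simp only [map_add, map_mul]
      linear_combination h
    · intro h
      have h' := congrArg φ h
      simp only [map_add, map_mul] at h'
      linear_combination h'
  have hlow := lower A B L N hL
  rw [hEe] at hE
  set n := L.card with hn
  set a := A.card
  set b := B.card
  have f1 : (n * N)^2 ≤ b * (4 * F.card * (60 * (s+1) + 2 * k)) := hlow.trans (Nat.mul_le_mul_left _ (by convert hE))
  rw [hFc] at f1 hs1
  have f2 : n * N^2 ≤ 4 * a * b * (60 * (s+1) + 2 * k) := by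
    have : n * (n * N^2) ≤ n * (4 * a * b * (60 * (s+1) + 2 * k)) := by nlinarith
    exact Nat.le_of_mul_le_mul_left this (by omega)
  rcases le_total k (60 * s) with hcase | hcase
  · have f3 : n * N^2 ≤ 960 * a * b * s := by
      refine f2.trans ?_
      have : 60 * (s+1) + 2 * k ≤ 240 * s := by omega
      calc _ ≤ 4 * a * b * (240 * s) := Nat.mul_le_mul_left _ this
        _ = _ := by ring
    have f4 : (n * N^2)^2 ≤ (960 * a * b * s)^2 := Nat.pow_le_pow_left f3 2
    have f5 : n * (n * N^4) ≤ n * (921600 * (a^3 * b^2)) := by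
      calc n * (n * N^4) = (n * N^2)^2 := by ring
        _ ≤ _ := f4
        _ = 921600 * a^2 * b^2 * (s * s) := by ring
        _ ≤ 921600 * a^2 * b^2 * (a * n) := Nat.mul_le_mul_left _ hs1
        _ = _ := by ring
    exact Nat.le_of_mul_le_mul_left f5 (by omega)
  · have f3 : n * N^2 ≤ 4 * a * b * (4 * k) := f2.trans (Nat.mul_le_mul_left _ (by omega))
    calc n * N^4 = n * N^2 * N * N := by ring
      _ ≤ 4 * a * b * (4 * k) * N * N := by gcongr
      _ = 16 * a * b * (k * N) * N := by ring
      _ ≤ 16 * a * b * (a * b) * a := by gcongr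
      _ = 16 * (a^3 * b^2) := by ring
      _ ≤ _ := by gcongr; norm_num

end Fin8

theorem card_lines_between_le :
    ∃ c : ℝ, 0 < c ∧ ∀ (p : ℕ) (_ : Fact p.Prime) (A B : Finset (ZMod p))
      (lam mu : ZMod p), lam ≠ 0 → mu ≠ 0 → A.card ≤ B.card →
      ∀ N : ℕ, 1 < N → (2 * A.card * B.card : ℝ) / p ≤ N → N ≤ A.card →
      ((Finset.univ : Finset (ZMod p × ZMod p)).filter
          (fun ab => N < inc A B (lam * ab.1) (mu * ab.2) ∧
            inc A B (lam * ab.1) (mu * ab.2) ≤ 2 * N)).card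
        ≤ c * min ((p : ℝ) * A.card * B.card / (N : ℝ) ^ 2)
            ((A.card : ℝ) ^ 3 * (B.card : ℝ) ^ 2 / (N : ℝ) ^ 4) := by
  refine ⟨921600, by norm_num, ?_⟩
  intro p hp A B lam mu hlam hmu hAB N hN1 hN2 hNA
  have hp0 : (0:ℝ) < p := by exact_mod_cast hp.out.pos
  have hpp : 0 < p := hp.out.pos
  have hN2' : 2 * A.card * B.card ≤ p * N := by
    rw [div_le_iff₀ hp0] at hN2
    have : ((2 * A.card * B.card : ℕ) : ℝ) ≤ ((p * N : ℕ) : ℝ) := by push_cast; linarith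
    exact_mod_cast this
  set L := (Finset.univ : Finset (ZMod p × ZMod p)).filter (fun l => N < inc A B l.1 l.2) with hLdef
  have hL : ∀ l ∈ L, N < inc A B l.1 l.2 := fun l hl => (Finset.mem_filter.mp hl).2
  have hcard : ((Finset.univ : Finset (ZMod p × ZMod p)).filter
          (fun ab => N < inc A B (lam * ab.1) (mu * ab.2) ∧
            inc A B (lam * ab.1) (mu * ab.2) ≤ 2 * N)).card ≤ L.card := by
    refine Finset.card_le_card_of_injOn (fun ab => (lam * ab.1, mu * ab.2)) ?_ ?_
    · intro u hu
      rw [Finset.mem_coe, Finset.mem_filter] at hu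
      exact Finset.mem_coe.mpr (Finset.mem_filter.mpr ⟨Finset.mem_univ _, hu.2.1⟩)
    · intro u _ v _ h
      rw [Prod.ext_iff] at h
      exact Prod.ext (mul_left_cancel₀ hlam h.1) (mul_left_cancel₀ hmu h.2)
  have h1 := second_moment A B L N hN2' hL
  have h2 : L.card * N^4 ≤ 921600 * (A.card^3 * B.card^2) := by
    by_cases hM : A.card * L.card ≤ 4 * p^2
    · exact main_bound A B L N hAB hN1 hNA hL hM
    push Not at hM
    set a := A.card
    set b := B.card
    set n := L.card
    have g1 : p * (p * N^2) ≤ p * (a^2 * b) := by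
      have i1 : a * (n * N^2) ≤ a * (4 * p * a * b) := Nat.mul_le_mul_left _ h1
      have i2 : 4 * p^2 * N^2 ≤ a * n * N^2 := Nat.mul_le_mul_right _ hM.le
      nlinarith
    have g2 : p * N^2 ≤ a^2 * b := Nat.le_of_mul_le_mul_left g1 hpp
    calc n * N^4 = n * N^2 * N^2 := by ring
      _ ≤ 4 * p * a * b * N^2 := Nat.mul_le_mul_right _ h1
      _ = 4 * a * b * (p * N^2) := by ring
      _ ≤ 4 * a * b * (a^2 * b) := Nat.mul_le_mul_left _ g2
      _ = 4 * (a^3 * b^2) := by ring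
      _ ≤ _ := by gcongr; norm_num
  have hNr : (0:ℝ) < N := by exact_mod_cast (by omega : 0 < N)
  have hc' : (((Finset.univ : Finset (ZMod p × ZMod p)).filter
          (fun ab => N < inc A B (lam * ab.1) (mu * ab.2) ∧
            inc A B (lam * ab.1) (mu * ab.2) ≤ 2 * N)).card : ℝ) ≤ (L.card : ℝ) := by exact_mod_cast hcard
  refine hc'.trans ?_
  have h1r : (L.card : ℝ) * (N:ℝ)^2 ≤ 4 * p * A.card * B.card := by exact_mod_cast h1
  have h2r : (L.card : ℝ) * (N:ℝ)^4 ≤ 921600 * ((A.card:ℝ)^3 * (B.card:ℝ)^2) := by exact_mod_cast h2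
  rw [mul_min_of_nonneg _ _ (by norm_num : (0:ℝ) ≤ 921600)]
  refine le_min ?_ ?_
  · rw [← mul_div_assoc, le_div_iff₀ (by positivity)]
    have : (0:ℝ) ≤ p * A.card * B.card := by positivity
    linarith
  · rw [← mul_div_assoc, le_div_iff₀ (by positivity)]
    exact h2r
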